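/- Let (W,S) be a finite Coxeter system with longest element w₀, let c be a Coxeter element, and let w ∈ W be c-sortable. Then the set {u ∈ W : w ≤ u in right weak order and every c-sortable element v with v ≤ u satisfies v ≤ w} (the fiber of w under the downward Cambrian projection π^c_↓) equals the singleton {w} if and only if ww₀ is c⁻¹-sortable. -/

import Mathlib

noncomputable section

namespace CambrianPaper

open CoxeterSystem

variable {B : Type*} {W : Type*} [Group W] {M : CoxeterMatrix B}

/-- One greedy pass of the letters of `c` over `u`: returns the taken letters (in order) and
the new remainder.  A letter `q` is taken if it is a left descent of the current remainder. -/
def pass (cs : CoxeterSystem M W) (c : List B) (u : W) : List B × W :=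
  c.foldl (fun p q =>
    if cs.length (cs.simple q * p.2) < cs.length p.2 then (p.1 ++ [q], cs.simple q * p.2)
    else p) ([], u)

/-- The remainder of `w` after `n` greedy passes of `c`. -/
def remainder (cs : CoxeterSystem M W) (c : List B) (w : W) : ℕ → W
  | 0 => w
  | n + 1 => (pass cs c (remainder cs c w n)).2

/-- The `n`-th factor (`n = 0, 1, 2, …`) of the `c`-factorization of `w`:
the letters of `c` taken in the `n`-th greedy pass.  (All but finitely many factors are
empty; the nonempty ones are the `c_{(K_i)}` of the `c`-factorization of `w`.) -/
def factor (cs : CoxeterSystem M W) (c : List B) (w : W) (n : ℕ) : List B :=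
  (pass cs c (remainder cs c w n)).1

/-- The `c`-sorting word of `w` : the concatenation of the factors of the
`c`-factorization of `w` (the lexicographically first reduced subword of `c^∞` for `w`);
`cs.length w` passes always suffice. -/
def sortingWord (cs : CoxeterSystem M W) (c : List B) (w : W) : List B :=
  ((List.range (cs.length w)).map (factor cs c w)).flatten

/-- `w` is `c`-sortable : the factors of its `c`-factorization are nested. -/
def IsSortable (cs : CoxeterSystem M W) (c : List B) (w : W) : Prop :=
  ∀ n : ℕ, ∀ q ∈ factor cs c w (n + 1), q ∈ factor cs c w n

/-- `w` is a `c`-singleton : `w` is `c`-sortable and `w w₀` is `c⁻¹`-sortable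
(the reduced word `c.reverse` represents the inverse of the Coxeter element). -/
def IsCSingleton (cs : CoxeterSystem M W) (c : List B) (w₀ w : W) : Prop :=
  IsSortable cs c w ∧ IsSortable cs c.reverse (w * w₀)

/-- The right weak order on `W`. -/
def weakLE (cs : CoxeterSystem M W) (u v : W) : Prop :=
  cs.length v = cs.length u + cs.length (u⁻¹ * v)

/-- A single commutation move on words: interchange two adjacent commuting letters. -/
def CommMove (M : CoxeterMatrix B) (l l' : List B) : Prop :=
  ∃ l₁ l₂ : List B, ∃ a b : B, M a b = 2 ∧ l = l₁ ++ a :: b :: l₂ ∧ l' = l₁ ++ b :: a :: l₂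

/-- Equivalence of words up to commutations. -/
def CommEquiv (M : CoxeterMatrix B) : List B → List B → Prop :=
  Relation.ReflTransGen (CommMove M)

/-- `u ∈ W` is a prefix of the word `v` up to commutations. -/
def IsPrefixUpToComm (cs : CoxeterSystem M W) (v : List B) (u : W) : Prop :=
  ∃ v' u' : List B, CommEquiv M v v' ∧ u' <+: v' ∧ cs.wordProd u' = u

section GeometricRepresentation

open Module

variable [Fintype B] [DecidableEq B]

/-- The simple root `α i`, as a basis vector of `B → ℝ`. -/
def simpleRoot (i : B) : B → ℝ := Pi.single i 1

/-- The Gram matrix of the standard geometric representation. -/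
def gram (M : CoxeterMatrix B) : Matrix B B ℝ :=
  Matrix.of fun i j => -Real.cos (Real.pi / M i j)

/-- The invariant symmetric bilinear form of the geometric representation. -/
def coxForm (M : CoxeterMatrix B) : LinearMap.BilinForm ℝ (B → ℝ) :=
  Matrix.toBilin' (gram M)

omit [Fintype B] in
lemma simpleRoot_self (i : B) : simpleRoot i i = 1 := by simp [simpleRoot]

omit [Fintype B] in
lemma simpleRoot_of_ne {i j : B} (h : j ≠ i) : simpleRoot i j = 0 := by simp [simpleRoot, h]

omit [Fintype B] in
lemma simpleRoot_nonneg (i : B) : 0 ≤ simpleRoot i := by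
  simp [simpleRoot]

omit [Fintype B] [DecidableEq B] in
lemma gram_symm (i j : B) : gram M i j = gram M j i := by
  simp [gram, M.symmetric i j]

omit [Fintype B] [DecidableEq B] in
lemma gram_self (i : B) : gram M i i = 1 := by simp [gram]

omit [Fintype B] [DecidableEq B] in
lemma gram_nonpos {i j : B} (h : i ≠ j) : gram M i j ≤ 0 := by
  have h1 := M.off_diagonal i j h
  simp only [gram, Matrix.of_apply, Left.neg_nonpos_iff]
  rcases Nat.eq_zero_or_pos (M i j) with h0 | h0
  · simp [h0]
  have h2 : (2 : ℝ) ≤ M i j := by exact_mod_cast (by lia : 2 ≤ M i j)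
  apply Real.cos_nonneg_of_neg_pi_div_two_le_of_le
  · have : 0 ≤ Real.pi / M i j := by positivity
    linarith [Real.pi_pos]
  · exact div_le_div_of_nonneg_left Real.pi_pos.le (by norm_num) h2

lemma coxForm_simpleRoot (i j : B) : coxForm M (simpleRoot i) (simpleRoot j) = gram M i j := by
  simp [coxForm, simpleRoot]

lemma coxForm_simpleRoot_left (i : B) (x : B → ℝ) :
    coxForm M (simpleRoot i) x = ∑ j, gram M i j * x j := by
  simp only [coxForm, simpleRoot, Matrix.toBilin'_apply', single_one_dotProduct]
  rfl

lemma coxForm_symm (x y : B → ℝ) : coxForm M x y = coxForm M y x := by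
  simp only [coxForm, Matrix.toBilin'_apply]
  rw [Finset.sum_comm]
  refine Finset.sum_congr rfl fun i _ => Finset.sum_congr rfl fun j _ => ?_
  rw [gram_symm j i]; ring

lemma coxForm_simpleRoot_self (i : B) : coxForm M (simpleRoot i) (simpleRoot i) = 1 := by
  rw [coxForm_simpleRoot, gram_self]

lemma two_smul_coxForm_self (i : B) :
    ((2 : ℝ) • coxForm M (simpleRoot i)) (simpleRoot i) = 2 := by
  simp [coxForm_simpleRoot_self]

/-- The simple reflection on `B → ℝ`. -/
def simpleRefl (M : CoxeterMatrix B) (i : B) : (B → ℝ) ≃ₗ[ℝ] (B → ℝ) :=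
  reflection (two_smul_coxForm_self (M := M) i)

lemma simpleRefl_apply (i : B) (x : B → ℝ) :
    simpleRefl M i x = x - (2 * coxForm M (simpleRoot i) x) • simpleRoot i := by
  simp [simpleRefl, reflection_apply]

lemma isLiftable_simpleRefl : M.IsLiftable (simpleRefl M) := by
  intro i j
  rcases eq_or_ne i j with rfl | hij
  · simp only [M.diagonal, pow_one]
    ext1 x
    exact involutive_reflection _ x
  have h1 := M.off_diagonal i j hij
  refine LinearEquiv.ext fun z => ?_
  have ht : 2 * Real.cos (2 * (Real.pi / M i j)) =
      ((2 : ℝ) • coxForm M (simpleRoot i)) (simpleRoot j) *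
        ((2 : ℝ) • coxForm M (simpleRoot j)) (simpleRoot i) - 2 := by
    simp only [LinearMap.smul_apply, coxForm_simpleRoot, smul_eq_mul, Real.cos_two_mul]
    rw [gram_symm j i]
    simp only [gram, Matrix.of_apply]
    ring
  have key := reflection_mul_reflection_pow_apply (two_smul_coxForm_self (M := M) i)
    (two_smul_coxForm_self (M := M) j) (M i j) z _ ht
  have goal_eq : (simpleRefl M i * simpleRefl M j) ^ M i j =
    (reflection (two_smul_coxForm_self (M := M) i) *
      reflection (two_smul_coxForm_self (M := M) j)) ^ M i j := rfl
  rw [goal_eq]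
  rcases Nat.eq_zero_or_pos (M i j) with h0 | h0
  · rw [h0]; simp
  rcases eq_or_ne (M i j) 2 with h2 | h2
  · rw [key]
    have hg : gram M i j = 0 := by simp [gram, h2]
    have hg' : gram M j i = 0 := by rw [gram_symm, hg]
    simp only [LinearMap.smul_apply, coxForm_simpleRoot, hg, hg', h2]
    have hc : (2 * (Real.pi / (2 : ℕ))) = Real.pi := by push_cast; ring
    rw [hc]
    norm_num [Polynomial.Chebyshev.S_neg_one]
    abel
  have hm : 3 ≤ M i j := by lia
  have hm' : (3 : ℝ) ≤ M i j := by exact_mod_cast hm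
  have hsin : Real.sin (2 * (Real.pi / M i j)) ≠ 0 := by
    apply ne_of_gt
    apply Real.sin_pos_of_pos_of_lt_pi
    · have := Real.pi_pos
      positivity
    · rw [← mul_div_assoc, div_lt_iff₀ (by linarith)]
      nlinarith [Real.pi_pos]
  have hS (n : ℤ) := Polynomial.Chebyshev.S_two_mul_real_cos (2 * (Real.pi / M i j)) n
  rw [key]
  rcases Nat.even_or_odd' (M i j) with ⟨k, hk | hk⟩
  · have e1 : ((M i j : ℤ) - 2) / 2 = k - 1 := by lia
    have e2 : ((M i j : ℤ) - 1) / 2 = k - 1 := by lia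
    have hz : (Polynomial.Chebyshev.S ℝ (k - 1)).eval
        (2 * Real.cos (2 * (Real.pi / M i j))) = 0 := by
      have := hS (k - 1)
      have e3 : (((k : ℤ) - 1 : ℤ) + 1 : ℝ) * (2 * (Real.pi / M i j)) = Real.pi := by
        rw [hk]; push_cast
        have : (k : ℝ) ≠ 0 := by
          intro h
          have : k = 0 := by exact_mod_cast h
          lia
        field_simp
        ring
      rw [e3, Real.sin_pi] at this
      exact (mul_eq_zero.1 this).resolve_right hsin
    rw [e1, e2, hz]
    simp
  · have e1 : ((M i j : ℤ) - 2) / 2 = k - 1 := by lia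
    have e2 : ((M i j : ℤ) - 1) / 2 = k := by lia
    have e3 : ((M i j : ℤ) - 3) / 2 = k - 1 := by lia
    have e4 : ((M i j : ℤ)) / 2 = k := by lia
    have hz : ((Polynomial.Chebyshev.S ℝ k).eval (2 * Real.cos (2 * (Real.pi / M i j)))) +
        ((Polynomial.Chebyshev.S ℝ (k - 1)).eval (2 * Real.cos (2 * (Real.pi / M i j)))) = 0 := by
      have h1 := hS k
      have h2 := hS (k - 1)
      have e3 : ((k : ℤ) + 1 : ℝ) * (2 * (Real.pi / M i j)) =
          2 * Real.pi - (((k : ℤ) - 1 : ℤ) + 1 : ℝ) * (2 * (Real.pi / M i j)) := by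
        rw [hk]; push_cast
        have : (2 * (k : ℝ) + 1) ≠ 0 := by positivity
        field_simp
        ring
      rw [e3, Real.sin_two_pi_sub] at h1
      have : (((Polynomial.Chebyshev.S ℝ k).eval (2 * Real.cos (2 * (Real.pi / M i j)))) +
        ((Polynomial.Chebyshev.S ℝ (k - 1)).eval (2 * Real.cos (2 * (Real.pi / M i j))))) *
          Real.sin (2 * (Real.pi / M i j)) = 0 := by
        rw [add_mul, h1, h2]; ring
      exact (mul_eq_zero.1 this).resolve_right hsin
    rw [e1, e2, e3, e4, hz]
    simp

/-- The standard geometric representation of a Coxeter group. -/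
def geomRep (cs : CoxeterSystem M W) : W →* ((B → ℝ) ≃ₗ[ℝ] (B → ℝ)) :=
  cs.lift ⟨simpleRefl M, isLiftable_simpleRefl⟩

variable (cs : CoxeterSystem M W)

lemma geomRep_simple (i : B) (x : B → ℝ) :
    geomRep cs (cs.simple i) x = x - (2 * coxForm M (simpleRoot i) x) • simpleRoot i := by
  rw [geomRep, CoxeterSystem.lift_apply_simple, simpleRefl_apply]

lemma geomRep_mul (u v : W) (x : B → ℝ) : geomRep cs (u * v) x = geomRep cs u (geomRep cs v x) := by
  rw [map_mul, LinearEquiv.mul_apply]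

lemma geomRep_one (x : B → ℝ) : geomRep cs 1 x = x := by
  rw [map_one]; rfl

lemma geomRep_inv_self (u : W) (x : B → ℝ) : geomRep cs u⁻¹ (geomRep cs u x) = x := by
  rw [← geomRep_mul, inv_mul_cancel, geomRep_one]

lemma geomRep_self_inv (u : W) (x : B → ℝ) : geomRep cs u (geomRep cs u⁻¹ x) = x := by
  rw [← geomRep_mul, mul_inv_cancel, geomRep_one]

lemma geomRep_simple_self (i : B) :
    geomRep cs (cs.simple i) (simpleRoot i) = -simpleRoot i := by
  rw [geomRep_simple, coxForm_simpleRoot_self]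
  module

lemma geomRep_simple_simple (i : B) (x : B → ℝ) :
    geomRep cs (cs.simple i) (geomRep cs (cs.simple i) x) = x := by
  rw [← geomRep_mul, cs.simple_mul_simple_self, geomRep_one]

lemma geomRep_simple_apply_of_ne {i j : B} (h : j ≠ i) (x : B → ℝ) :
    geomRep cs (cs.simple i) x j = x j := by
  rw [geomRep_simple]
  simp [simpleRoot_of_ne h]

lemma coxForm_geomRep (w : W) (x y : B → ℝ) :
    coxForm M (geomRep cs w x) (geomRep cs w y) = coxForm M x y := by
  induction w using cs.simple_induction_left generalizing x y with
  | one => simp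
  | mul_simple_left w i ih =>
    rw [geomRep_mul, geomRep_mul, ← ih x y, geomRep_simple, geomRep_simple]
    simp only [map_sub, map_smul, LinearMap.sub_apply, LinearMap.smul_apply, smul_eq_mul,
      coxForm_simpleRoot_self]
    rw [coxForm_symm _ (simpleRoot i)]
    ring

end GeometricRepresentation

section Positivity

open Module

variable [Fintype B] [DecidableEq B] (cs : CoxeterSystem M W)

lemma sum_smul_simpleRoot (x : B → ℝ) : ∑ j, x j • simpleRoot j = x := by
  ext k
  simp [Finset.sum_apply, simpleRoot, Pi.single_apply]

omit [Fintype B] [DecidableEq B] in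
lemma chebyshevS_eval_nonneg {i j : B} (hij : i ≠ j) {n : ℕ} (hn : M i j = 0 ∨ n ≤ M i j) :
    0 ≤ (Polynomial.Chebyshev.S ℝ ((n : ℤ) - 1)).eval (2 * Real.cos (Real.pi / M i j)) := by
  rcases Nat.eq_zero_or_pos (M i j) with h0 | h0
  · rw [h0]
    simp only [Nat.cast_zero, div_zero, Real.cos_zero, mul_one, Polynomial.Chebyshev.S_eval_two]
    push_cast
    simp
  have hn' : n ≤ M i j := by lia
  have h2 : 2 ≤ M i j := by have := M.off_diagonal i j hij; lia
  have h2' : (2 : ℝ) ≤ M i j := by exact_mod_cast h2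
  have hsin : 0 < Real.sin (Real.pi / M i j) := by
    apply Real.sin_pos_of_pos_of_lt_pi
    · have := Real.pi_pos
      positivity
    · rw [div_lt_iff₀ (by linarith)]
      nlinarith [Real.pi_pos]
  have h := Polynomial.Chebyshev.S_two_mul_real_cos (Real.pi / M i j) ((n : ℤ) - 1)
  refine nonneg_of_mul_nonneg_left (b := Real.sin (Real.pi / M i j)) ?_ hsin
  rw [h]
  push_cast
  have hn'' : (n : ℝ) ≤ M i j := by exact_mod_cast hn'
  apply Real.sin_nonneg_of_nonneg_of_le_pi
  · have := Real.pi_pos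
    ring_nf
    positivity
  · have hp := Real.pi_pos
    rw [mul_div_assoc', div_le_iff₀ (by linarith)]
    nlinarith

lemma geomRep_alternatingWord (i t : B) (k : ℕ) :
    geomRep cs (cs.wordProd (alternatingWord i t k)) (simpleRoot i) =
      if Even k then
        (Polynomial.Chebyshev.S ℝ k).eval (2 * Real.cos (Real.pi / M i t)) • simpleRoot i +
        (Polynomial.Chebyshev.S ℝ ((k : ℤ) - 1)).eval (2 * Real.cos (Real.pi / M i t)) •
          simpleRoot t
      else
        (Polynomial.Chebyshev.S ℝ ((k : ℤ) - 1)).eval (2 * Real.cos (Real.pi / M i t)) •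
          simpleRoot i +
        (Polynomial.Chebyshev.S ℝ k).eval (2 * Real.cos (Real.pi / M i t)) • simpleRoot t := by
  induction k with
  | zero => simp [alternatingWord]
  | succ k ih =>
    have hS := congrArg (Polynomial.eval (2 * Real.cos (Real.pi / M i t)))
      (Polynomial.Chebyshev.S_add_one ℝ k)
    simp only [Polynomial.eval_sub, Polynomial.eval_mul, Polynomial.eval_X] at hS
    rw [alternatingWord_succ', CoxeterSystem.wordProd_cons, geomRep_mul, ih]
    have hg : gram M t i = - Real.cos (Real.pi / M i t) := by rw [gram_symm]; simp [gram]
    have hg' : gram M i t = - Real.cos (Real.pi / M i t) := by simp [gram]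
    rcases Nat.even_or_odd k with hk | hk
    · have hk' : ¬ Even (k + 1) := by simpa [Nat.even_add_one] using hk
      simp only [hk, hk', if_true, if_false]
      rw [geomRep_simple]
      simp only [map_add, map_smul, coxForm_simpleRoot, gram_self, hg, smul_eq_mul]
      push_cast
      rw [hS, add_sub_cancel_right]
      module
    · have hk' : Even (k + 1) := by simpa [Nat.even_add_one] using hk
      have hk'' : ¬ Even k := by simpa using hk
      simp only [hk'', hk', if_true, if_false]
      rw [geomRep_simple]
      simp only [map_add, map_smul, coxForm_simpleRoot, gram_self, hg', smul_eq_mul]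
      push_cast
      rw [hS, add_sub_cancel_right]
      module

omit [Fintype B] [DecidableEq B] in
lemma exists_eq_mul_alternatingWord_of_le {w : W} {i t : B} {k n : ℕ} (hkn : k ≤ n)
    (h : ∃ v, w = v * cs.wordProd (alternatingWord i t n) ∧ cs.length v + n = cs.length w) :
    ∃ v, w = v * cs.wordProd (alternatingWord i t k) ∧ cs.length v + k = cs.length w := by
  induction n, hkn using Nat.le_induction with
  | base => exact h
  | succ n _ ih =>
    apply ih
    obtain ⟨v, hv, hl⟩ := h
    rw [alternatingWord_succ', CoxeterSystem.wordProd_cons, ← mul_assoc] at hv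
    refine ⟨_, hv, ?_⟩
    have h1 := cs.length_mul_le (v * cs.simple (if Even n then t else i))
      (cs.wordProd (alternatingWord i t n))
    have h2 := cs.length_wordProd_le (alternatingWord i t n)
    rw [← hv] at h1
    rw [length_alternatingWord] at h2
    have h3 := cs.length_mul_le v (cs.simple (if Even n then t else i))
    rw [cs.length_simple] at h3
    lia

/-- If `w < w s`, then `w` sends the simple root of `s` to a nonnegative vector. -/
theorem geomRep_simpleRoot_nonneg {w : W} {i : B}
    (h : cs.length w < cs.length (w * cs.simple i)) : 0 ≤ geomRep cs w (simpleRoot i) := by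
  induction hn : cs.length w using Nat.strong_induction_on generalizing w i with
  | _ n ih =>
  subst hn
  rcases eq_or_ne w 1 with rfl | hw
  · rw [geomRep_one]; exact simpleRoot_nonneg i
  obtain ⟨t, ht⟩ := cs.exists_rightDescent_of_ne_one hw
  have hti : i ≠ t := by
    rintro rfl
    exact lt_asymm h ht
  classical
  let p : ℕ → Prop := fun k =>
    ∃ v, w = v * cs.wordProd (alternatingWord i t k) ∧ cs.length v + k = cs.length w
  have p1 : p 1 := by
    refine ⟨w * cs.simple t, ?_, ?_⟩
    · simp [alternatingWord]
    · exact (cs.isRightDescent_iff).1 ht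
  have pb : ∀ k, p k → k ≤ cs.length w := fun k ⟨v, _, hv⟩ => by lia
  set k := Nat.findGreatest p (cs.length w) with hk
  have hpk : p k := Nat.findGreatest_spec (P := p) (pb 1 p1) p1
  have hpk1 : ¬ p (k + 1) := fun hp =>
    Nat.findGreatest_is_greatest (P := p) (Nat.lt_succ_self _) (pb _ hp) hp
  have hk1 : 1 ≤ k := Nat.le_findGreatest (pb 1 p1) p1
  have hkm : M i t = 0 ∨ k + 1 ≤ M i t := by
    by_contra! hc
    obtain ⟨h0, hlt⟩ := hc
    obtain ⟨v, hv, hl⟩ := exists_eq_mul_alternatingWord_of_le cs (Nat.lt_succ_iff.1 hlt) hpk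
    have hbr := cs.wordProd_braidWord_eq i t
    rw [braidWord, braidWord, ← M.symmetric i t] at hbr
    rw [hbr] at hv
    obtain ⟨m, hm⟩ := Nat.exists_eq_succ_of_ne_zero h0
    rw [hm, Nat.succ_eq_add_one, alternatingWord_succ, List.concat_eq_append,
      CoxeterSystem.wordProd_append, CoxeterSystem.wordProd_singleton, ← mul_assoc] at hv
    have hwi : w * cs.simple i = v * cs.wordProd (alternatingWord i t m) := by
      rw [hv]; simp
    have h1 := cs.length_mul_le v (cs.wordProd (alternatingWord i t m))
    have h2 := cs.length_wordProd_le (alternatingWord i t m)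
    rw [length_alternatingWord] at h2
    rw [← hwi] at h1
    lia
  obtain ⟨v, hv, hl⟩ := hpk
  have hnext : cs.length v < cs.length (v * cs.simple (if Even k then t else i)) := by
    by_contra hc
    apply hpk1
    refine ⟨v * cs.simple (if Even k then t else i), ?_, ?_⟩
    · rw [alternatingWord_succ', CoxeterSystem.wordProd_cons, ← mul_assoc]
      simpa using hv
    · have := cs.length_mul_simple v (if Even k then t else i)
      lia
  have hprev : cs.length v < cs.length (v * cs.simple (if Even k then i else t)) := by
    by_contra hc
    obtain ⟨m, hm⟩ := Nat.exists_eq_succ_of_ne_zero (by lia : k ≠ 0)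
    have hpar : (if Even k then i else t) = (if Even m then t else i) := by
      rw [hm, Nat.succ_eq_add_one]
      by_cases he : Even m <;> simp [Nat.even_add_one, he]
    have hw' : w = v * cs.simple (if Even k then i else t) *
        cs.wordProd (alternatingWord i t m) := by
      rw [hv, hpar, hm, Nat.succ_eq_add_one, alternatingWord_succ', CoxeterSystem.wordProd_cons,
        ← mul_assoc]
    have h1 := cs.length_mul_le (v * cs.simple (if Even k then i else t))
      (cs.wordProd (alternatingWord i t m))
    have h2 := cs.length_wordProd_le (alternatingWord i t m)
    rw [length_alternatingWord] at h2
    rw [← hw'] at h1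
    have := cs.length_mul_simple v (if Even k then i else t)
    lia
  have hvi : 0 ≤ geomRep cs v (simpleRoot i) := by
    by_cases he : Even k
    · simp only [he, if_true] at hprev
      exact ih _ (by lia) hprev rfl
    · simp only [he, if_false] at hnext
      exact ih _ (by lia) hnext rfl
  have hvt : 0 ≤ geomRep cs v (simpleRoot t) := by
    by_cases he : Even k
    · simp only [he, if_true] at hnext
      exact ih _ (by lia) hnext rfl
    · simp only [he, if_false] at hprev
      exact ih _ (by lia) hprev rfl
  have c1 := chebyshevS_eval_nonneg (M := M) hti (n := k) (by lia)
  have c2 := chebyshevS_eval_nonneg (M := M) hti (n := k + 1) hkm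
  push_cast at c2
  rw [add_sub_cancel_right] at c2
  rw [hv, geomRep_mul, geomRep_alternatingWord]
  split_ifs <;> rw [map_add, map_smul, map_smul] <;>
    exact add_nonneg (smul_nonneg (by assumption) (by assumption))
      (smul_nonneg (by assumption) (by assumption))

theorem geomRep_simpleRoot_nonpos {w : W} {i : B}
    (h : cs.length (w * cs.simple i) < cs.length w) : geomRep cs w (simpleRoot i) ≤ 0 := by
  have := geomRep_simpleRoot_nonneg cs (w := w * cs.simple i) (i := i) (by simpa using h)
  rwa [geomRep_mul, geomRep_simple_self, map_neg, Left.nonneg_neg_iff] at this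

end Positivity

section Roots

open Module

variable [Fintype B] [DecidableEq B] (cs : CoxeterSystem M W)

/-- Positive roots of the geometric representation. -/
def IsPosRoot (β : B → ℝ) : Prop :=
  (∃ w i, geomRep cs w (simpleRoot i) = β) ∧ 0 ≤ β

/-- `β` is an inversion of `w`: a positive root made negative by `w⁻¹`. -/
def IsInv (w : W) (β : B → ℝ) : Prop :=
  IsPosRoot cs β ∧ geomRep cs w⁻¹ β ≤ 0

variable {cs}

omit [Fintype B] [DecidableEq B] in
lemma length_lt_mul_simple_of_not_lt {w : W} {i : B}
    (h : ¬ cs.length (w * cs.simple i) < cs.length w) :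
    cs.length w < cs.length (w * cs.simple i) := by
  have := cs.length_mul_simple w i
  lia

omit [Fintype B] [DecidableEq B] in
lemma eq_zero_of_nonneg_of_nonpos {x : B → ℝ} (h : 0 ≤ x) (h' : x ≤ 0) : x = 0 :=
  le_antisymm h' h

lemma coxForm_simpleRoot_le {y : B → ℝ} (hy : 0 ≤ y) (s : B) :
    coxForm M (simpleRoot s) y ≤ y s := by
  rw [coxForm_simpleRoot_left]
  calc ∑ j, gram M s j * y j ≤ ∑ j, if j = s then y j else 0 := by
        refine Finset.sum_le_sum fun j _ => ?_
        split_ifs with h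
        · rw [h, gram_self, one_mul]
        · exact mul_nonpos_of_nonpos_of_nonneg (gram_nonpos (Ne.symm h)) (hy j)
    _ = y s := by simp

lemma isPosRoot_simpleRoot (i : B) : IsPosRoot cs (simpleRoot i) :=
  ⟨⟨1, i, geomRep_one cs _⟩, simpleRoot_nonneg i⟩

lemma geomRep_simpleRoot_nonneg_or_nonpos (w : W) (i : B) :
    0 ≤ geomRep cs w (simpleRoot i) ∨ geomRep cs w (simpleRoot i) ≤ 0 := by
  by_cases h : cs.length (w * cs.simple i) < cs.length w
  · exact Or.inr (geomRep_simpleRoot_nonpos cs h)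
  · exact Or.inl (geomRep_simpleRoot_nonneg cs (length_lt_mul_simple_of_not_lt h))

namespace IsPosRoot

variable {β ρ γ : B → ℝ} {a b : ℝ} {r : B}

lemma coxForm_self (h : IsPosRoot cs β) : coxForm M β β = 1 := by
  obtain ⟨⟨w, i, rfl⟩, -⟩ := h
  rw [coxForm_geomRep, coxForm_simpleRoot_self]

lemma ne_zero (h : IsPosRoot cs β) : β ≠ 0 := by
  rintro rfl
  simpa using h.coxForm_self

lemma not_nonpos (h : IsPosRoot cs β) : ¬ β ≤ 0 := fun h' =>
  h.ne_zero (eq_zero_of_nonneg_of_nonpos h.2 h')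

lemma geomRep (h : IsPosRoot cs β) (w : W) (h' : 0 ≤ geomRep cs w β) :
    IsPosRoot cs (CambrianPaper.geomRep cs w β) := by
  obtain ⟨⟨v, i, rfl⟩, -⟩ := h
  exact ⟨⟨w * v, i, geomRep_mul cs w v _⟩, h'⟩

lemma nonneg_or_nonpos (h : IsPosRoot cs β) (w : W) :
    0 ≤ CambrianPaper.geomRep cs w β ∨ CambrianPaper.geomRep cs w β ≤ 0 := by
  obtain ⟨⟨v, i, rfl⟩, -⟩ := h
  rw [← geomRep_mul]
  exact geomRep_simpleRoot_nonneg_or_nonpos _ _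

lemma neg_geomRep (h : IsPosRoot cs β) (w : W) (h' : CambrianPaper.geomRep cs w β ≤ 0) :
    IsPosRoot cs (-CambrianPaper.geomRep cs w β) := by
  obtain ⟨⟨v, i, rfl⟩, -⟩ := h
  refine ⟨⟨w * v * cs.simple i, i, ?_⟩, by simpa using h'⟩
  rw [geomRep_mul, geomRep_simple_self, map_neg, geomRep_mul]

lemma eq_simpleRoot (h : IsPosRoot cs β) (h' : ∀ j, j ≠ r → β j = 0) : β = simpleRoot r := by
  have hβ : β = β r • simpleRoot r := by
    ext j
    rcases eq_or_ne j r with rfl | hj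
    · simp [simpleRoot_self]
    · simp [h' j hj, simpleRoot_of_ne hj]
  have h1 := h.coxForm_self
  rw [hβ] at h1
  simp only [map_smul, LinearMap.smul_apply, coxForm_simpleRoot_self, smul_eq_mul,
    mul_one] at h1
  have h0 : 0 ≤ β r := h.2 r
  have : β r = 1 := by nlinarith
  rw [hβ, this, one_smul]

lemma exists_pos_of_ne_simpleRoot (h : IsPosRoot cs β) (hne : β ≠ simpleRoot r) :
    ∃ j, j ≠ r ∧ 0 < β j := by
  by_contra! hc
  exact hne (h.eq_simpleRoot fun j hj => le_antisymm (hc j hj) (h.2 j))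

/-- A simple reflection permutes the positive roots other than its own simple root. -/
lemma simple (h : IsPosRoot cs β) (hne : β ≠ simpleRoot r) :
    IsPosRoot cs (CambrianPaper.geomRep cs (cs.simple r) β) := by
  refine h.geomRep _ ((h.nonneg_or_nonpos _).resolve_right fun hc => ?_)
  obtain ⟨j, hj, hpos⟩ := h.exists_pos_of_ne_simpleRoot hne
  have := hc j
  rw [geomRep_simple_apply_of_ne cs hj] at this
  exact absurd this (not_le.2 hpos)

lemma simple_ne (h : IsPosRoot cs β) :
    CambrianPaper.geomRep cs (cs.simple r) β ≠ simpleRoot r := fun hc => by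
  have := congrArg (CambrianPaper.geomRep cs (cs.simple r)) hc
  rw [geomRep_simple_simple, geomRep_simple_self] at this
  have h1 := h.2 r
  rw [this] at h1
  simp [simpleRoot_self] at h1
  linarith

lemma eq_simpleRoot_of_eq_add (hρ : IsPosRoot cs ρ) (hγ : IsPosRoot cs γ) (ha : 0 < a) (hb : 0 < b)
    (h : simpleRoot r = a • ρ + b • γ) : ρ = simpleRoot r ∧ γ = simpleRoot r := by
  have key : ∀ j, j ≠ r → ρ j = 0 ∧ γ j = 0 := by
    intro j hj
    have h1 := congrFun h j
    simp only [simpleRoot_of_ne hj, Pi.add_apply, Pi.smul_apply, smul_eq_mul] at h1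
    have h2 : 0 ≤ ρ j := hρ.2 j
    have h3 : 0 ≤ γ j := hγ.2 j
    have h4 : 0 ≤ a * ρ j := by positivity
    have h5 : 0 ≤ b * γ j := by positivity
    have h6 : a * ρ j = 0 := by linarith
    have h7 : b * γ j = 0 := by linarith
    exact ⟨(mul_eq_zero.1 h6).resolve_left ha.ne', (mul_eq_zero.1 h7).resolve_left hb.ne'⟩
  exact ⟨hρ.eq_simpleRoot fun j hj => (key j hj).1, hγ.eq_simpleRoot fun j hj => (key j hj).2⟩

lemma inv_of_not_isInv (h : IsPosRoot cs β) {w : W} (h' : ¬ IsInv cs w β) :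
    IsPosRoot cs (CambrianPaper.geomRep cs w⁻¹ β) :=
  h.geomRep _ ((h.nonneg_or_nonpos _).resolve_right fun hc => h' ⟨h, hc⟩)

end IsPosRoot

namespace IsInv

variable {β ρ γ : B → ℝ} {a b : ℝ} {r : B} {w : W}

lemma neg_isPosRoot (h : IsInv cs w β) : IsPosRoot cs (-geomRep cs w⁻¹ β) :=
  h.1.neg_geomRep _ h.2

lemma add (hρ : IsInv cs w ρ) (hγ : IsInv cs w γ) (ha : 0 < a) (hb : 0 < b)
    (hβ : IsPosRoot cs β) (h : β = a • ρ + b • γ) : IsInv cs w β := by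
  refine ⟨hβ, ?_⟩
  rw [h, map_add, map_smul, map_smul]
  exact add_nonpos (smul_nonpos_of_nonneg_of_nonpos ha.le hρ.2)
    (smul_nonpos_of_nonneg_of_nonpos hb.le hγ.2)

lemma or_of_add (hβ : IsInv cs w β) (hρ : IsPosRoot cs ρ) (hγ : IsPosRoot cs γ) (ha : 0 < a)
    (hb : 0 < b) (h : β = a • ρ + b • γ) : IsInv cs w ρ ∨ IsInv cs w γ := by
  by_contra! hc
  have h1 := hρ.inv_of_not_isInv hc.1
  have h2 := hγ.inv_of_not_isInv hc.2
  have h3 := hβ.2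
  have h4 := hβ.neg_isPosRoot.ne_zero
  rw [h, map_add, map_smul, map_smul] at h3 h4
  refine h4 (neg_eq_zero.2 (eq_zero_of_nonneg_of_nonpos ?_ h3))
  exact add_nonneg (smul_nonneg ha.le h1.2) (smul_nonneg hb.le h2.2)

lemma mul_simple (h : IsInv cs w β) (hr : cs.length w < cs.length (w * cs.simple r)) :
    IsInv cs (w * cs.simple r) β := by
  refine ⟨h.1, ?_⟩
  have h1 := h.neg_isPosRoot
  have h2 : -geomRep cs w⁻¹ β ≠ simpleRoot r := by
    intro hc
    have h3 := geomRep_simpleRoot_nonneg cs hr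
    rw [← hc, map_neg, geomRep_self_inv, Left.nonneg_neg_iff] at h3
    exact h.1.not_nonpos h3
  have h3 := (h1.simple h2).2
  rw [map_neg, Left.nonneg_neg_iff] at h3
  rwa [mul_inv_rev, cs.inv_simple, geomRep_mul]

lemma mul_right {y : W} (h : IsInv cs w β) (hy : cs.length (w * y) = cs.length w + cs.length y) :
    IsInv cs (w * y) β := by
  induction hn : cs.length y generalizing y with
  | zero =>
    rw [cs.length_eq_zero_iff] at hn
    simpa [hn] using h
  | succ n ih =>
    have hy1 : y ≠ 1 := by
      rintro rfl
      simp at hn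
    obtain ⟨t, ht⟩ := cs.exists_rightDescent_of_ne_one hy1
    have ht' := (cs.isRightDescent_iff).1 ht
    have e : w * y = w * (y * cs.simple t) * cs.simple t := by
      rw [mul_assoc, mul_assoc, cs.simple_mul_simple_self, mul_one]
    have h1 := cs.length_mul_le w (y * cs.simple t)
    have h2 := cs.length_mul_le (w * (y * cs.simple t)) (cs.simple t)
    rw [cs.length_simple, ← e] at h2
    have h3 := ih (y := y * cs.simple t) (by lia) (by lia)
    rw [e]
    apply h3.mul_simple
    rw [← e]
    lia

end IsInv

lemma isInv_simpleRoot_iff {w : W} {s : B} :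
    IsInv cs w (simpleRoot s) ↔ cs.length (cs.simple s * w) < cs.length w := by
  have e1 : cs.length (w⁻¹ * cs.simple s) = cs.length (cs.simple s * w) := by
    rw [← cs.length_inv, mul_inv_rev, cs.inv_simple, inv_inv]
  rw [← e1, ← cs.length_inv w]
  constructor
  · intro h
    by_contra hc
    have h1 := geomRep_simpleRoot_nonneg cs (length_lt_mul_simple_of_not_lt hc)
    exact h.neg_isPosRoot.ne_zero (neg_eq_zero.2 (eq_zero_of_nonneg_of_nonpos h1 h.2))
  · intro h
    exact ⟨isPosRoot_simpleRoot s, geomRep_simpleRoot_nonpos cs h⟩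

lemma isInv_simple_mul_iff {w : W} {s : B} {β : B → ℝ} (hβ : IsPosRoot cs β)
    (hne : β ≠ simpleRoot s) :
    IsInv cs (cs.simple s * w) (geomRep cs (cs.simple s) β) ↔ IsInv cs w β := by
  unfold IsInv
  rw [mul_inv_rev, cs.inv_simple, geomRep_mul, geomRep_simple_simple]
  simp only [hβ, hβ.simple hne]

lemma isInv_mul_simple_iff {w : W} {r : B} {β : B → ℝ}
    (hr : cs.length w < cs.length (w * cs.simple r)) :
    IsInv cs (w * cs.simple r) β ↔ IsInv cs w β ∨ β = geomRep cs w (simpleRoot r) := by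
  constructor
  · intro h
    by_contra! hc
    have h1 := h.1.inv_of_not_isInv hc.1
    have h2 : geomRep cs w⁻¹ β ≠ simpleRoot r := fun h2 => hc.2 (by
      rw [← h2, geomRep_self_inv])
    have h3 := h.2
    rw [mul_inv_rev, cs.inv_simple, geomRep_mul] at h3
    exact (h1.simple h2).not_nonpos h3
  · rintro (h | rfl)
    · exact h.mul_simple hr
    · refine ⟨(isPosRoot_simpleRoot r).geomRep _ (geomRep_simpleRoot_nonneg cs hr), ?_⟩
      rw [mul_inv_rev, cs.inv_simple, geomRep_mul, geomRep_inv_self, geomRep_simple_self]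
      simpa using simpleRoot_nonneg r

lemma not_isInv_one (β : B → ℝ) : ¬ IsInv cs 1 β := fun h => by
  have := h.2
  rw [inv_one, geomRep_one] at this
  exact h.1.not_nonpos this

omit [Fintype B] [DecidableEq B] in
lemma eq_one_of_no_leftDescent {w : W}
    (h : ∀ s, ¬ cs.length (cs.simple s * w) < cs.length w) : w = 1 := by
  by_contra hw
  obtain ⟨s, hs⟩ := cs.exists_leftDescent_of_ne_one hw
  exact h s hs

lemma isInv_wordProd {l₁ l₂ : List B} {a : B} (h : cs.IsReduced (l₁ ++ a :: l₂)) :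
    IsInv cs (cs.wordProd (l₁ ++ a :: l₂)) (geomRep cs (cs.wordProd l₁) (simpleRoot a)) := by
  have e : l₁ ++ a :: l₂ = (l₁ ++ [a]) ++ l₂ := by simp
  rw [e] at h ⊢
  have h1 := h.take (l₁ ++ [a]).length
  have h2 := h.drop (l₁ ++ [a]).length
  rw [List.take_left] at h1
  rw [List.drop_left] at h2
  have h3 := h1.take l₁.length
  rw [List.take_left] at h3
  rw [CoxeterSystem.wordProd_append]
  have h4 : IsInv cs (cs.wordProd (l₁ ++ [a])) (geomRep cs (cs.wordProd l₁) (simpleRoot a)) := by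
    rw [CoxeterSystem.wordProd_append, CoxeterSystem.wordProd_singleton]
    refine (isInv_mul_simple_iff ?_).2 (Or.inr rfl)
    have := h1
    unfold CoxeterSystem.IsReduced at this h3
    rw [CoxeterSystem.wordProd_append, CoxeterSystem.wordProd_singleton] at this
    simp at this
    lia
  refine h4.mul_right ?_
  rw [← CoxeterSystem.wordProd_append]
  unfold CoxeterSystem.IsReduced at h h1 h2
  rw [h, h1, h2, List.length_append]

end Roots

section Parabolic

variable (cs : CoxeterSystem M W)

/-- `v` is a product of simple reflections with letters in `J`. -/
def IsWordIn (J : List B) (v : W) : Prop := ∃ l : List B, l ⊆ J ∧ cs.wordProd l = v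

variable {cs} {J : List B} {v : W}

namespace IsWordIn

lemma simple_mul (h : IsWordIn cs J v) {a : B} (ha : a ∈ J) :
    IsWordIn cs J (cs.simple a * v) := by
  obtain ⟨l, hl, rfl⟩ := h
  exact ⟨a :: l, List.cons_subset.2 ⟨ha, hl⟩, cs.wordProd_cons a l⟩

lemma mul_simple (h : IsWordIn cs J v) {a : B} (ha : a ∈ J) :
    IsWordIn cs J (v * cs.simple a) := by
  obtain ⟨l, hl, rfl⟩ := h
  exact ⟨l ++ [a], by simp [hl, ha], by simp [CoxeterSystem.wordProd_append]⟩

lemma inv (h : IsWordIn cs J v) : IsWordIn cs J v⁻¹ := by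
  obtain ⟨l, hl, rfl⟩ := h
  exact ⟨l.reverse, by simpa using hl, by simp⟩

variable [Fintype B] [DecidableEq B]

lemma geomRep_apply (h : IsWordIn cs J v) {j : B} (hj : j ∉ J) (x : B → ℝ) :
    geomRep cs v x j = x j := by
  obtain ⟨l, hl, rfl⟩ := h
  induction l with
  | nil => simp
  | cons a l ih =>
    rw [List.cons_subset] at hl
    rw [CoxeterSystem.wordProd_cons, geomRep_mul, geomRep_simple_apply_of_ne, ih hl.2]
    rintro rfl
    exact hj hl.1

lemma mem_of_isInv_simpleRoot (h : IsWordIn cs J v) {a : B}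
    (ha : cs.length (cs.simple a * v) < cs.length v) : a ∈ J := by
  by_contra hc
  have h1 := (isInv_simpleRoot_iff.2 ha).2 a
  rw [h.inv.geomRep_apply hc, simpleRoot_self] at h1
  simp at h1
  linarith

omit [Fintype B] [DecidableEq B] in
/-- An element of a standard parabolic subgroup has a reduced word in that subgroup. -/
lemma exists_isReduced [Finite B] (h : IsWordIn cs J v) :
    ∃ l : List B, l ⊆ J ∧ cs.IsReduced l ∧ cs.wordProd l = v := by
  classical
  have := Fintype.ofFinite B
  induction hn : cs.length v generalizing v with
  | zero =>
    rw [cs.length_eq_zero_iff] at hn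
    exact ⟨[], by simp, by simp [CoxeterSystem.IsReduced], by simp [hn]⟩
  | succ n ih =>
    have hv1 : v ≠ 1 := by
      rintro rfl
      simp at hn
    obtain ⟨a, ha⟩ := cs.exists_leftDescent_of_ne_one hv1
    have haJ := h.mem_of_isInv_simpleRoot ha
    have ha' := (cs.isLeftDescent_iff).1 ha
    obtain ⟨l, hl, hr, hp⟩ := ih (h.simple_mul haJ) (by lia)
    refine ⟨a :: l, List.cons_subset.2 ⟨haJ, hl⟩, ?_, ?_⟩
    · unfold CoxeterSystem.IsReduced at hr ⊢
      rw [CoxeterSystem.wordProd_cons, hp, CoxeterSystem.simple_mul_simple_cancel_left,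
        List.length_cons, ← hr, hp]
      lia
    · rw [CoxeterSystem.wordProd_cons, hp, CoxeterSystem.simple_mul_simple_cancel_left]

end IsWordIn

end Parabolic

section SkewForm

variable (M) in
/-- The pairing of the simple root of `s` with the part of `y` supported on the letters of `c`. -/
def rowSum (s : B) (c : List B) (y : B → ℝ) : ℝ := (c.map fun j => gram M s j * y j).sum

variable (M) in
/-- The off-diagonal part of the Euler form of the word `c`. -/
def eulerForm : List B → (B → ℝ) → (B → ℝ) → ℝ
  | [], _, _ => 0
  | s :: c, x, y => eulerForm c x y - x s * rowSum M s c y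

variable (M) in
/-- The skew-symmetric form attached to the word `c`. -/
def skewForm (c : List B) (x y : B → ℝ) : ℝ := eulerForm M c x y - eulerForm M c y x

/-- `x` is supported on the letters of `c`. -/
def SuppIn (c : List B) (x : B → ℝ) : Prop := ∀ j, j ∉ c → x j = 0

variable {c : List B} {s : B} {x y x' y' : B → ℝ}

lemma rowSum_congr (h : ∀ j ∈ c, y j = y' j) : rowSum M s c y = rowSum M s c y' := by
  unfold rowSum
  congr 1
  exact List.map_congr_left fun j hj => by rw [h j hj]

lemma rowSum_add : rowSum M s c (y + y') = rowSum M s c y + rowSum M s c y' := by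
  simp [rowSum, mul_add, List.sum_map_add]

lemma rowSum_smul (a : ℝ) : rowSum M s c (a • y) = a * rowSum M s c y := by
  simp only [rowSum, Pi.smul_apply, smul_eq_mul, ← List.sum_map_mul_left]
  congr 1
  exact List.map_congr_left fun j _ => by ring

lemma eulerForm_congr (hx : ∀ j ∈ c, x j = x' j) (hy : ∀ j ∈ c, y j = y' j) :
    eulerForm M c x y = eulerForm M c x' y' := by
  induction c with
  | nil => rfl
  | cons s c ih =>
    simp only [List.mem_cons, forall_eq_or_imp] at hx hy
    simp only [eulerForm, ih hx.2 hy.2, hx.1, rowSum_congr (M := M) (s := s) hy.2]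

lemma eulerForm_zero_left : eulerForm M c 0 y = 0 := by
  induction c with
  | nil => rfl
  | cons s c ih => simp [eulerForm, ih]

lemma eulerForm_zero_right : eulerForm M c x 0 = 0 := by
  induction c with
  | nil => rfl
  | cons s c ih => simp [eulerForm, ih, rowSum]

lemma eulerForm_append_singleton :
    eulerForm M (c ++ [s]) x y = eulerForm M c x y - rowSum M s c x * y s := by
  induction c with
  | nil => simp [eulerForm, rowSum]
  | cons t c ih =>
    simp only [List.cons_append, eulerForm, ih, rowSum, List.map_append, List.sum_append,
      List.map_cons, List.sum_cons, List.map_nil, List.sum_nil]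
    rw [gram_symm t s]
    ring

lemma eulerForm_reverse : eulerForm M c.reverse x y = eulerForm M c y x := by
  induction c with
  | nil => rfl
  | cons s c ih =>
    rw [List.reverse_cons, eulerForm_append_singleton, ih, eulerForm]
    have : rowSum M s c.reverse x = rowSum M s c x := by simp [rowSum, List.sum_reverse]
    rw [this]
    ring

lemma eulerForm_add_left : eulerForm M c (x + x') y = eulerForm M c x y + eulerForm M c x' y := by
  induction c with
  | nil => simp [eulerForm]
  | cons s c ih => simp only [eulerForm, ih, Pi.add_apply]; ring

lemma eulerForm_add_right : eulerForm M c x (y + y') = eulerForm M c x y + eulerForm M c x y' := by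
  induction c with
  | nil => simp [eulerForm]
  | cons s c ih => simp only [eulerForm, ih, rowSum_add]; ring

lemma eulerForm_smul_left (a : ℝ) : eulerForm M c (a • x) y = a * eulerForm M c x y := by
  induction c with
  | nil => simp [eulerForm]
  | cons s c ih => simp only [eulerForm, ih, Pi.smul_apply, smul_eq_mul]; ring

lemma eulerForm_smul_right (a : ℝ) : eulerForm M c x (a • y) = a * eulerForm M c x y := by
  induction c with
  | nil => simp [eulerForm]
  | cons s c ih => simp only [eulerForm, ih, rowSum_smul]; ring

lemma skewForm_self : skewForm M c x x = 0 := sub_self _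

lemma skewForm_swap : skewForm M c y x = -skewForm M c x y := by simp [skewForm]

lemma skewForm_reverse : skewForm M c.reverse x y = skewForm M c y x := by
  simp [skewForm, eulerForm_reverse]

lemma skewForm_add_left : skewForm M c (x + x') y = skewForm M c x y + skewForm M c x' y := by
  simp only [skewForm, eulerForm_add_left, eulerForm_add_right]; ring

lemma skewForm_add_right : skewForm M c x (y + y') = skewForm M c x y + skewForm M c x y' := by
  simp only [skewForm, eulerForm_add_left, eulerForm_add_right]; ring

lemma skewForm_smul_left (a : ℝ) : skewForm M c (a • x) y = a * skewForm M c x y := by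
  simp only [skewForm, eulerForm_smul_left, eulerForm_smul_right]; ring

lemma skewForm_smul_right (a : ℝ) : skewForm M c x (a • y) = a * skewForm M c x y := by
  simp only [skewForm, eulerForm_smul_left, eulerForm_smul_right]; ring

/-- If neither argument involves the first letter, that letter may be dropped. -/
lemma skewForm_cons_of_eq_zero (hx : x s = 0) (hy : y s = 0) :
    skewForm M (s :: c) x y = skewForm M c x y := by
  simp [skewForm, eulerForm, hx, hy]

variable [Fintype B] [DecidableEq B]

lemma coxForm_eq_add_rowSum (hnd : (s :: c).Nodup) (hy : SuppIn (s :: c) y) :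
    coxForm M (simpleRoot s) y = y s + rowSum M s c y := by
  have h : rowSum M s (s :: c) y = y s + rowSum M s c y := by
    simp [rowSum, gram_self]
  rw [coxForm_simpleRoot_left, ← h, rowSum, ← List.sum_toFinset _ hnd]
  symm
  refine Finset.sum_subset (Finset.subset_univ _) fun j _ hj => ?_
  rw [hy j (by simpa using hj), mul_zero]

lemma skewForm_cons_eq (hnd : (s :: c).Nodup) (hx : SuppIn (s :: c) x) (hy : SuppIn (s :: c) y) :
    skewForm M (s :: c) x y = skewForm M (c ++ [s]) x y
      - 2 * x s * coxForm M (simpleRoot s) y + 2 * y s * coxForm M (simpleRoot s) x := by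
  rw [coxForm_eq_add_rowSum hnd hx, coxForm_eq_add_rowSum hnd hy]
  simp only [skewForm, eulerForm, eulerForm_append_singleton]
  ring

lemma skewForm_rotate (cs : CoxeterSystem M W) (hnd : (s :: c).Nodup) (hx : SuppIn (s :: c) x)
    (hy : SuppIn (s :: c) y) :
    skewForm M (c ++ [s]) (geomRep cs (cs.simple s) x) (geomRep cs (cs.simple s) y) =
      skewForm M (s :: c) x y := by
  have key (z : B → ℝ) : ∀ j ∈ c, geomRep cs (cs.simple s) z j = z j := fun j hj =>
    geomRep_simple_apply_of_ne cs (by rintro rfl; exact (List.nodup_cons.1 hnd).1 hj) z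
  have hs (z : B → ℝ) (hz : SuppIn (s :: c) z) :
      geomRep cs (cs.simple s) z s = -z s - 2 * rowSum M s c z := by
    rw [geomRep_simple, coxForm_eq_add_rowSum hnd hz]
    simp only [Pi.sub_apply, Pi.smul_apply, simpleRoot_self, smul_eq_mul]
    ring
  simp only [skewForm, eulerForm, eulerForm_append_singleton, eulerForm_congr (key x) (key y),
    eulerForm_congr (key y) (key x), rowSum_congr (key x), rowSum_congr (key y), hs x hx, hs y hy]
  ring

lemma skewForm_cons_simpleRoot (hnd : (s :: c).Nodup) (hy : SuppIn (s :: c) y) :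
    skewForm M (s :: c) (simpleRoot s) y = y s - coxForm M (simpleRoot s) y := by
  have h0 : ∀ j ∈ c, simpleRoot s j = (0 : B → ℝ) j := fun j hj =>
    simpleRoot_of_ne (by rintro rfl; exact (List.nodup_cons.1 hnd).1 hj)
  have h1 : ∀ j ∈ c, y j = y j := fun _ _ => rfl
  rw [coxForm_eq_add_rowSum hnd hy]
  simp only [skewForm, eulerForm, eulerForm_congr h0 h1, eulerForm_congr h1 h0, rowSum_congr h0,
    eulerForm_zero_left, eulerForm_zero_right, simpleRoot_self]
  simp [rowSum]

lemma skewForm_append_simpleRoot (hnd : (s :: c).Nodup) (hy : SuppIn (s :: c) y) :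
    skewForm M (c ++ [s]) (simpleRoot s) y = coxForm M (simpleRoot s) y - y s := by
  have hs : SuppIn (s :: c) (simpleRoot s) := fun j hj =>
    simpleRoot_of_ne (by rintro rfl; exact hj List.mem_cons_self)
  have h := skewForm_cons_eq (M := M) hnd hs hy
  rw [skewForm_cons_simpleRoot hnd hy, coxForm_simpleRoot_self, simpleRoot_self] at h
  linarith

end SkewForm

section Alignment

variable [Fintype B] [DecidableEq B] (cs : CoxeterSystem M W)

/-- Positive roots `ρ`, `γ` with `0 < skewForm M c ρ γ`, and a positive root `β` strictly inside
the cone they span. -/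
structure IsTriple (c : List B) (ρ γ β : B → ℝ) : Prop where
  left : IsPosRoot cs ρ
  right : IsPosRoot cs γ
  mid : IsPosRoot cs β
  comb : ∃ a b : ℝ, 0 < a ∧ 0 < b ∧ β = a • ρ + b • γ
  skew_pos : 0 < skewForm M c ρ γ

/-- `w` is `c`-aligned. -/
def IsAligned (c : List B) (w : W) : Prop :=
  ∀ ρ γ β, IsTriple cs c ρ γ β → IsInv cs w β → IsInv cs w ρ

/-- `w` is `c`-antialigned: the condition dual to `IsAligned` under `w ↦ w * w₀`. -/
def IsAntialigned (c : List B) (w : W) : Prop :=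
  ∀ ρ γ β, IsTriple cs c ρ γ β → IsInv cs w γ → IsInv cs w β

/-- Every inversion of `w` is supported on the letters of `c`. -/
def InvSuppIn (c : List B) (w : W) : Prop := ∀ β, IsInv cs w β → SuppIn c β

/-- Some cover `w s_r` of `w` in the right weak order has its new inversion inside a triple whose
right end is an inversion of `w` and whose left end is not. -/
def HasContractedCover (c : List B) (w : W) : Prop :=
  ∃ r ρ γ, IsTriple cs c ρ γ (geomRep cs w (simpleRoot r)) ∧ IsInv cs w γ ∧ ¬ IsInv cs w ρ

variable {cs} {c : List B} {s : B} {ρ γ β : B → ℝ} {w v : W}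

omit [Fintype B] [DecidableEq B] in
lemma nodup_rotate (h : (s :: c).Nodup) : (c ++ [s]).Nodup :=
  List.nodup_append_comm.1 h

omit [Fintype B] [DecidableEq B] in
lemma suppIn_rotate {x : B → ℝ} : SuppIn (c ++ [s]) x ↔ SuppIn (s :: c) x := by
  simp [SuppIn, or_comm]

omit [Fintype B] in
lemma suppIn_simpleRoot : SuppIn (s :: c) (simpleRoot s) := fun j hj =>
  simpleRoot_of_ne (by rintro rfl; exact hj List.mem_cons_self)

lemma SuppIn.simple {x : B → ℝ} (h : SuppIn (s :: c) x) :
    SuppIn (s :: c) (geomRep cs (cs.simple s) x) := fun j hj => by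
  rw [geomRep_simple_apply_of_ne cs, h j hj]
  rintro rfl
  exact hj List.mem_cons_self

lemma isInv_simple_mul_iff' (hβ : IsPosRoot cs β) (hne : β ≠ simpleRoot s) :
    IsInv cs (cs.simple s * w) β ↔ IsInv cs w (geomRep cs (cs.simple s) β) := by
  have := isInv_simple_mul_iff (w := w) (hβ.simple hne) hβ.simple_ne
  rwa [geomRep_simple_simple] at this

omit [Fintype B] [DecidableEq B] in
lemma not_lt_simple_mul (h : cs.length (cs.simple s * w) < cs.length w) :
    ¬ cs.length (cs.simple s * (cs.simple s * w)) < cs.length (cs.simple s * w) := by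
  rw [cs.simple_mul_simple_cancel_left]
  exact lt_asymm h

lemma IsInv.ne_simpleRoot (h : IsInv cs w β)
    (hs : ¬ cs.length (cs.simple s * w) < cs.length w) : β ≠ simpleRoot s := by
  rintro rfl
  exact hs (isInv_simpleRoot_iff.1 h)

lemma skewForm_cons_simpleRoot_nonneg (hnd : (s :: c).Nodup) (hβ : IsPosRoot cs β)
    (hs : SuppIn (s :: c) β) : 0 ≤ skewForm M (s :: c) (simpleRoot s) β := by
  rw [skewForm_cons_simpleRoot hnd hs]
  linarith [coxForm_simpleRoot_le (M := M) hβ.2 s]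

namespace IsTriple

lemma suppIn_left {d : List B} (h : IsTriple cs c ρ γ β) (hβ : SuppIn d β) :
    SuppIn d ρ := fun j hj => by
  obtain ⟨a, b, ha, hb, rfl⟩ := h.comb
  have h1 := hβ j hj
  have h2 : 0 ≤ ρ j := h.left.2 j
  have h3 : 0 ≤ γ j := h.right.2 j
  simp only [Pi.add_apply, Pi.smul_apply, smul_eq_mul] at h1
  have h4 : 0 ≤ b * γ j := by positivity
  have h5 : 0 ≤ a * ρ j := by positivity
  exact (mul_eq_zero.1 (by linarith : a * ρ j = 0)).resolve_left ha.ne'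

lemma suppIn_right {d : List B} (h : IsTriple cs c ρ γ β) (hβ : SuppIn d β) :
    SuppIn d γ := fun j hj => by
  obtain ⟨a, b, ha, hb, rfl⟩ := h.comb
  have h1 := hβ j hj
  have h2 := h.suppIn_left hβ j hj
  simp only [Pi.add_apply, Pi.smul_apply, smul_eq_mul, h2, mul_zero, zero_add] at h1
  exact (mul_eq_zero.1 h1).resolve_left hb.ne'

lemma mid_ne (h : IsTriple cs c ρ γ β) (r : B) : β ≠ simpleRoot r := by
  rintro rfl
  obtain ⟨a, b, ha, hb, hab⟩ := h.comb
  obtain ⟨h1, h2⟩ := h.left.eq_simpleRoot_of_eq_add h.right ha hb hab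
  have := h.skew_pos
  rw [h1, h2, skewForm_self] at this
  exact lt_irrefl _ this

lemma right_ne (h : IsTriple cs (s :: c) ρ γ β) (hnd : (s :: c).Nodup)
    (hs : SuppIn (s :: c) ρ) : γ ≠ simpleRoot s := by
  rintro rfl
  have h1 := h.skew_pos
  rw [skewForm_swap] at h1
  linarith [skewForm_cons_simpleRoot_nonneg hnd h.left hs]

lemma left_ne (h : IsTriple cs (c ++ [s]) ρ γ β) (hnd : (s :: c).Nodup)
    (hs : SuppIn (s :: c) γ) : ρ ≠ simpleRoot s := by
  rintro rfl
  have h1 := h.skew_pos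
  rw [skewForm_append_simpleRoot hnd hs] at h1
  linarith [coxForm_simpleRoot_le (M := M) h.right.2 s]

lemma rotate (h : IsTriple cs (s :: c) ρ γ β) (hnd : (s :: c).Nodup) (hρ : ρ ≠ simpleRoot s)
    (hs : SuppIn (s :: c) β) :
    IsTriple cs (c ++ [s]) (geomRep cs (cs.simple s) ρ) (geomRep cs (cs.simple s) γ)
      (geomRep cs (cs.simple s) β) where
  left := h.left.simple hρ
  right := h.right.simple (h.right_ne hnd (h.suppIn_left hs))
  mid := h.mid.simple (h.mid_ne s)
  comb := by
    obtain ⟨a, b, ha, hb, rfl⟩ := h.comb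
    exact ⟨a, b, ha, hb, by simp⟩
  skew_pos := by
    rw [skewForm_rotate cs hnd (h.suppIn_left hs) (h.suppIn_right hs)]
    exact h.skew_pos

lemma rotate_symm (h : IsTriple cs (c ++ [s]) ρ γ β) (hnd : (s :: c).Nodup)
    (hγ : γ ≠ simpleRoot s) (hs : SuppIn (s :: c) β) :
    IsTriple cs (s :: c) (geomRep cs (cs.simple s) ρ) (geomRep cs (cs.simple s) γ)
      (geomRep cs (cs.simple s) β) := by
  have h1 := h.suppIn_left hs
  have h2 := h.suppIn_right hs
  refine ⟨h.left.simple (h.left_ne hnd h2), h.right.simple hγ, h.mid.simple (h.mid_ne s), ?_, ?_⟩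
  · obtain ⟨a, b, ha, hb, rfl⟩ := h.comb
    exact ⟨a, b, ha, hb, by simp⟩
  · rw [← skewForm_rotate cs hnd h1.simple h2.simple, geomRep_simple_simple,
      geomRep_simple_simple]
    exact h.skew_pos

lemma cons_iff (hβ : SuppIn c β) (hs : s ∉ c) :
    IsTriple cs (s :: c) ρ γ β ↔ IsTriple cs c ρ γ β := by
  constructor
  · intro h
    have := h.skew_pos
    rw [skewForm_cons_of_eq_zero (h.suppIn_left hβ s hs) (h.suppIn_right hβ s hs)] at this
    exact ⟨h.left, h.right, h.mid, h.comb, this⟩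
  · intro h
    have := h.skew_pos
    rw [← skewForm_cons_of_eq_zero (h.suppIn_left hβ s hs) (h.suppIn_right hβ s hs)] at this
    exact ⟨h.left, h.right, h.mid, h.comb, this⟩

end IsTriple

lemma InvSuppIn.of_simple_mul (h : InvSuppIn cs (c ++ [s]) (cs.simple s * w)) :
    InvSuppIn cs (s :: c) w := fun β hβ => by
  by_cases hne : β = simpleRoot s
  · exact hne ▸ suppIn_simpleRoot
  · have := (suppIn_rotate.1 (h _ ((isInv_simple_mul_iff hβ.1 hne).2 hβ))).simple (cs := cs)
    rwa [geomRep_simple_simple] at this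

lemma InvSuppIn.simple_mul (h : InvSuppIn cs (s :: c) w)
    (hs : cs.length (cs.simple s * w) < cs.length w) :
    InvSuppIn cs (c ++ [s]) (cs.simple s * w) := fun β hβ => by
  have hne := hβ.ne_simpleRoot (not_lt_simple_mul hs)
  have := (h _ ((isInv_simple_mul_iff' hβ.1 hne).1 hβ)).simple (cs := cs)
  rw [geomRep_simple_simple] at this
  exact suppIn_rotate.2 this

lemma IsAligned.of_simple_mul (h : IsAligned cs (c ++ [s]) (cs.simple s * w))
    (hsupp : InvSuppIn cs (s :: c) w) (hnd : (s :: c).Nodup)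
    (hs : cs.length (cs.simple s * w) < cs.length w) : IsAligned cs (s :: c) w := by
  intro ρ γ β ht hβ
  by_cases hρ : ρ = simpleRoot s
  · rw [hρ]; exact isInv_simpleRoot_iff.2 hs
  · have := h _ _ _ (ht.rotate hnd hρ (hsupp β hβ))
      ((isInv_simple_mul_iff ht.mid (ht.mid_ne s)).2 hβ)
    exact (isInv_simple_mul_iff ht.left hρ).1 this

lemma IsAligned.simple_mul (h : IsAligned cs (s :: c) w) (hsupp : InvSuppIn cs (s :: c) w)
    (hnd : (s :: c).Nodup) (hs : cs.length (cs.simple s * w) < cs.length w) :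
    IsAligned cs (c ++ [s]) (cs.simple s * w) := by
  intro ρ γ β ht hβ
  have hsβ := suppIn_rotate.1 (hsupp.simple_mul hs β hβ)
  have hρ := ht.left_ne hnd (ht.suppIn_right hsβ)
  have hβ' := (isInv_simple_mul_iff' ht.mid (ht.mid_ne s)).1 hβ
  rw [isInv_simple_mul_iff' ht.left hρ]
  by_cases hγ : γ = simpleRoot s
  · obtain ⟨a, b, ha, hb, hab⟩ := ht.comb
    refine hβ'.add (isInv_simpleRoot_iff.2 hs) (inv_pos.2 ha) (mul_pos (inv_pos.2 ha) hb)
      (ht.left.simple hρ) ?_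
    rw [hab, hγ, map_add, map_smul, map_smul, geomRep_simple_self, smul_add, smul_smul,
      inv_mul_cancel₀ ha.ne']
    module
  · exact h _ _ _ (ht.rotate_symm hnd hγ hsβ) hβ'

lemma IsAligned.cons_iff (hsupp : InvSuppIn cs c w) (hs : s ∉ c) :
    IsAligned cs (s :: c) w ↔ IsAligned cs c w := by
  constructor
  · intro h ρ γ β ht hβ
    exact h ρ γ β ((IsTriple.cons_iff (hsupp β hβ) hs).2 ht) hβ
  · intro h ρ γ β ht hβ
    exact h ρ γ β ((IsTriple.cons_iff (hsupp β hβ) hs).1 ht) hβ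

lemma InvSuppIn.cons (h : InvSuppIn cs c w) : InvSuppIn cs (s :: c) w := fun β hβ j hj =>
  h β hβ j fun hc => hj (List.mem_cons_of_mem _ hc)

lemma invSuppIn_of_forall_mem (hall : ∀ b, b ∈ c) : InvSuppIn cs c w := fun _ _ j hj =>
  absurd (hall j) hj

lemma IsWordIn.isPosRoot {J : List B} (hv : IsWordIn cs J v) (hs : s ∉ J) :
    IsPosRoot cs (geomRep cs v (simpleRoot s)) := by
  refine (isPosRoot_simpleRoot s).geomRep v
    ((geomRep_simpleRoot_nonneg_or_nonpos v s).resolve_right fun h => ?_)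
  have := h s
  rw [hv.geomRep_apply hs, simpleRoot_self] at this
  simp at this
  linarith

lemma exists_split_of_skewForm_lt (c : List B) (β : B → ℝ) {l : List B} (hl : s ∉ l)
    (h : skewForm M c β (simpleRoot s) <
      skewForm M c β (geomRep cs (cs.wordProd l) (simpleRoot s))) :
    ∃ l₁ a l₂, l = l₁ ++ a :: l₂ ∧
      0 < skewForm M c β (geomRep cs (cs.wordProd l₁) (simpleRoot a)) := by
  induction l using List.reverseRecOn with
  | nil => simp at h
  | append_singleton l a ih =>
    simp only [List.mem_append, List.mem_singleton, not_or] at hl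
    have hg : gram M a s ≤ 0 := gram_nonpos (Ne.symm hl.2)
    have e : geomRep cs (cs.wordProd (l ++ [a])) (simpleRoot s) =
        geomRep cs (cs.wordProd l) (simpleRoot s) +
          (-2 * gram M a s) • geomRep cs (cs.wordProd l) (simpleRoot a) := by
      rw [CoxeterSystem.wordProd_append, CoxeterSystem.wordProd_singleton, geomRep_mul,
        geomRep_simple, coxForm_simpleRoot, map_sub, map_smul]
      module
    rw [e, skewForm_add_right, skewForm_smul_right] at h
    by_cases h1 : 0 < skewForm M c β (geomRep cs (cs.wordProd l) (simpleRoot a))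
    · exact ⟨l, a, [], rfl, h1⟩
    · obtain ⟨l₁, a', l₂, rfl, hpos⟩ := ih hl.1 (by nlinarith)
      exact ⟨l₁, a', l₂ ++ [a], by simp, hpos⟩

/-- If `v` lies in the parabolic subgroup of the remaining letters and moves the simple root of the
first letter `s`, then the image of that root is the middle of a triple whose left end is the image
under a shorter element. -/
theorem exists_isTriple_of_ne (hnd : (s :: c).Nodup) (hv : IsWordIn cs c v)
    (hne : geomRep cs v (simpleRoot s) ≠ simpleRoot s) :
    ∃ v' γ, IsWordIn cs c v' ∧ cs.length v' < cs.length v ∧ IsInv cs v γ ∧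
      IsTriple cs (s :: c) (geomRep cs v' (simpleRoot s)) γ (geomRep cs v (simpleRoot s)) := by
  have hsc : s ∉ c := (List.nodup_cons.1 hnd).1
  induction hn : cs.length v using Nat.strong_induction_on generalizing v with
  | _ n ih =>
  subst hn
  by_cases hdesc : ∃ a, cs.length (v * cs.simple a) < cs.length v ∧ gram M s a = 0
  · obtain ⟨a, ha, hg⟩ := hdesc
    have hac : a ∈ c := by
      apply hv.inv.mem_of_isInv_simpleRoot
      rwa [← cs.inv_simple, ← mul_inv_rev, cs.length_inv, cs.length_inv]
    have e : geomRep cs (v * cs.simple a) (simpleRoot s) = geomRep cs v (simpleRoot s) := by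
      rw [geomRep_mul, geomRep_simple, coxForm_simpleRoot, gram_symm, hg]
      simp
    obtain ⟨v', γ, h1, h2, h3, h4⟩ := ih _ ha (hv.mul_simple hac) (by rwa [e]) rfl
    refine ⟨v', γ, h1, h2.trans ha, ?_, by rwa [e] at h4⟩
    have := h3.mul_simple (r := a) (by simpa using ha)
    simpa using this
  push Not at hdesc
  obtain ⟨l, hlc, hred, rfl⟩ := hv.exists_isReduced
  set β := geomRep cs (cs.wordProd l) (simpleRoot s) with hβ
  have hsl : s ∉ l := fun h => hsc (hlc h)
  have hβpos : IsPosRoot cs β := hv.isPosRoot hsc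
  have hβs : β s = 1 := by rw [hβ, hv.geomRep_apply hsc, simpleRoot_self]
  have hβsupp : SuppIn (s :: c) β := fun j hj => by
    rw [List.mem_cons, not_or] at hj
    rw [hβ, hv.geomRep_apply hj.2, simpleRoot_of_ne hj.1]
  have hlt : coxForm M (simpleRoot s) β < 1 := by
    refine lt_of_le_of_ne (hβs ▸ coxForm_simpleRoot_le hβpos.2 s) fun h => ?_
    have := (hβpos.simple hne).2 s
    rw [geomRep_simple, h] at this
    norm_num [simpleRoot_self, hβs] at this
  have hskew : skewForm M (s :: c) β (simpleRoot s) < skewForm M (s :: c) β β := by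
    rw [skewForm_self, skewForm_swap, skewForm_cons_simpleRoot hnd hβsupp, hβs]
    linarith
  obtain ⟨l₁, a, l₂, rfl, hpos⟩ := exists_split_of_skewForm_lt (s :: c) β hsl hskew
  have hl₁ : l₁ ⊆ c := fun x hx => hlc (by simp [hx])
  have hl₂ : l₂ ⊆ c := fun x hx => hlc (by simp [hx])
  have hac : a ∈ c := hlc (by simp)
  have has : s ≠ a := by rintro rfl; exact hsc hac
  have hw₁ : IsWordIn cs c (cs.wordProd l₁) := ⟨l₁, hl₁, rfl⟩
  have hw' : IsWordIn cs c (cs.wordProd (l₁ ++ l₂)) :=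
    ⟨l₁ ++ l₂, by simp [hl₁, hl₂], rfl⟩
  set γ := geomRep cs (cs.wordProd l₁) (simpleRoot a) with hγ
  have hγinv := isInv_wordProd hred
  rw [← hγ] at hγinv
  set v := cs.wordProd (l₁ ++ a :: l₂) with hv_def
  set δ := -geomRep cs v⁻¹ γ with hδ
  have hδpos : IsPosRoot cs δ := hγinv.neg_isPosRoot
  have hδsupp : SuppIn c δ := fun j hj => by
    rw [hδ, Pi.neg_apply, hv.inv.geomRep_apply hj, hγ, hw₁.geomRep_apply hj, simpleRoot_of_ne,
      neg_zero]
    rintro rfl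
    exact hj hac
  have hvδ : geomRep cs v δ = -γ := by rw [hδ, map_neg, geomRep_self_inv]
  have hβγ : coxForm M β γ = -coxForm M (simpleRoot s) δ := by
    rw [hβ, ← coxForm_geomRep cs v (simpleRoot s) δ, hvδ, map_neg, neg_neg]
  have hle : coxForm M (simpleRoot s) δ ≤ 0 := hδsupp s hsc ▸ coxForm_simpleRoot_le hδpos.2 s
  have hneg : coxForm M (simpleRoot s) δ ≠ 0 := fun h0 => by
    rw [coxForm_simpleRoot_left] at h0
    have hterm : ∀ j ∈ Finset.univ, gram M s j * δ j ≤ 0 := fun j _ => by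
      rcases eq_or_ne s j with rfl | hj
      · rw [hδsupp s hsc, mul_zero]
      · exact mul_nonpos_of_nonpos_of_nonneg (gram_nonpos hj) (hδpos.2 j)
    have hz := (Finset.sum_eq_zero_iff_of_nonpos hterm).1 h0
    have hnn : 0 ≤ geomRep cs v δ := by
      rw [← sum_smul_simpleRoot δ, map_sum]
      refine Finset.sum_nonneg fun j _ => ?_
      rw [map_smul]
      rcases eq_or_ne (δ j) 0 with h | h
      · rw [h, zero_smul]
      · refine smul_nonneg (hδpos.2 j) (geomRep_simpleRoot_nonneg cs
          (length_lt_mul_simple_of_not_lt fun hd => hdesc j hd ?_))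
        exact (mul_eq_zero.1 (hz j (Finset.mem_univ j))).resolve_right h
    rw [hvδ, Left.nonneg_neg_iff] at hnn
    exact hγinv.1.not_nonpos hnn
  have hb : 0 < 2 * coxForm M β γ := by
    have := lt_of_le_of_ne hle hneg
    linarith
  have e₁ : cs.wordProd (l₁ ++ a :: l₂) =
      cs.wordProd l₁ * cs.simple a * cs.wordProd l₂ := by
    rw [CoxeterSystem.wordProd_append, CoxeterSystem.wordProd_cons, mul_assoc]
  have hρ : β = geomRep cs (cs.wordProd (l₁ ++ l₂)) (simpleRoot s) + (2 * coxForm M β γ) • γ := by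
    have h1 : coxForm M β γ =
        -coxForm M (simpleRoot a) (geomRep cs (cs.wordProd l₂) (simpleRoot s)) := by
      rw [hβ, hv_def, e₁, geomRep_mul, geomRep_mul, hγ, coxForm_geomRep,
        ← coxForm_geomRep cs (cs.simple a), geomRep_simple_simple, geomRep_simple_self, map_neg,
        coxForm_symm]
    rw [h1, hβ, hv_def, e₁, geomRep_mul, geomRep_mul, geomRep_simple, map_sub, map_smul,
      CoxeterSystem.wordProd_append, geomRep_mul, hγ]
    module
  refine ⟨_, γ, hw', ?_, hγinv, hw'.isPosRoot hsc, hγinv.1, hβpos,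
    ⟨1, _, one_pos, hb, by rw [one_smul]; exact hρ⟩, ?_⟩
  · have h1 := cs.length_wordProd_le (l₁ ++ l₂)
    unfold CoxeterSystem.IsReduced at hred
    rw [hv_def, hred]
    simp only [List.length_append, List.length_cons] at h1 ⊢
    lia
  · rw [hρ, skewForm_add_left, skewForm_smul_left, skewForm_self] at hpos
    simpa using hpos

lemma IsAligned.isInv_simpleRoot (h : IsAligned cs (s :: c) w) (hnd : (s :: c).Nodup)
    (hv : IsWordIn cs c v) (hinv : IsInv cs w (geomRep cs v (simpleRoot s))) :
    IsInv cs w (simpleRoot s) := by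
  induction hn : cs.length v using Nat.strong_induction_on generalizing v with
  | _ n ih =>
  subst hn
  by_cases hne : geomRep cs v (simpleRoot s) = simpleRoot s
  · rwa [hne] at hinv
  obtain ⟨v', γ, hv', hlt, -, ht⟩ := exists_isTriple_of_ne hnd hv hne
  exact ih _ hlt hv' (h _ _ _ ht hinv) rfl

omit [Fintype B] [DecidableEq B] in
lemma subset_or_exists_split (J l : List B) :
    l ⊆ J ∨ ∃ l₁ a l₂, l = l₁ ++ a :: l₂ ∧ l₁ ⊆ J ∧ a ∉ J := by
  induction l with
  | nil => simp
  | cons x l ih =>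
    by_cases hx : x ∈ J
    · rcases ih with h | ⟨l₁, a, l₂, rfl, h₁, ha⟩
      · exact Or.inl (List.cons_subset.2 ⟨hx, h⟩)
      · exact Or.inr ⟨x :: l₁, a, l₂, rfl, List.cons_subset.2 ⟨hx, h₁⟩, ha⟩
    · exact Or.inr ⟨[], x, l, rfl, by simp, hx⟩

/-- If `w` is aligned and the first letter is not a left descent, then `w` lies in the parabolic
subgroup of the remaining letters. -/
theorem IsAligned.isWordIn (h : IsAligned cs (s :: c) w) (hsupp : InvSuppIn cs (s :: c) w)
    (hnd : (s :: c).Nodup) (hs : ¬ cs.length (cs.simple s * w) < cs.length w) :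
    IsWordIn cs c w := by
  obtain ⟨l, hred, rfl⟩ := cs.exists_isReduced w
  rcases subset_or_exists_split c l with hl | ⟨l₁, a, l₂, rfl, h₁, ha⟩
  · exact ⟨l, hl, rfl⟩
  · exfalso
    have hinv := isInv_wordProd hred
    have hw₁ : IsWordIn cs c (cs.wordProd l₁) := ⟨l₁, h₁, rfl⟩
    have has : a = s := by
      by_contra hne
      have := hsupp _ hinv a (by simp [hne, ha])
      rw [hw₁.geomRep_apply ha, simpleRoot_self] at this
      exact one_ne_zero this
    subst has
    exact hs (isInv_simpleRoot_iff.1 (h.isInv_simpleRoot hnd hw₁ hinv))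

lemma IsWordIn.invSuppIn {J : List B} (h : IsWordIn cs J w) : InvSuppIn cs J w := by
  intro β hβ j hj
  have h1 := hβ.2 j
  rw [h.inv.geomRep_apply hj] at h1
  exact le_antisymm h1 (hβ.1.2 j)

end Alignment

section GreedySorting

variable (cs : CoxeterSystem M W)

/-- Recursive form of sortability: strip the first letter of `c` from the left if it is a left
descent, moving it to the end of the word, and drop it from the word otherwise. -/
inductive GreedySortable : List B → W → Prop
  | one : GreedySortable [] 1
  | take {s : B} {c : List B} {w : W} : cs.length (cs.simple s * w) < cs.length w →
      GreedySortable (c ++ [s]) (cs.simple s * w) → GreedySortable (s :: c) w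
  | skip {s : B} {c : List B} {w : W} : ¬ cs.length (cs.simple s * w) < cs.length w →
      GreedySortable c w → GreedySortable (s :: c) w

variable {cs} [Fintype B] [DecidableEq B] {c : List B} {w : W}

theorem GreedySortable.invSuppIn_and_isAligned (h : GreedySortable cs c w) (hnd : c.Nodup) :
    InvSuppIn cs c w ∧ IsAligned cs c w := by
  induction h with
  | one =>
    exact ⟨fun β hβ => absurd hβ (not_isInv_one β), fun _ _ β _ hβ => absurd hβ (not_isInv_one β)⟩
  | take hs _ ih =>
    obtain ⟨h1, h2⟩ := ih (nodup_rotate hnd)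
    exact ⟨h1.of_simple_mul, h2.of_simple_mul h1.of_simple_mul hnd hs⟩
  | skip hs _ ih =>
    obtain ⟨hs', hnd'⟩ := List.nodup_cons.1 hnd
    obtain ⟨h1, h2⟩ := ih hnd'
    exact ⟨h1.cons, (IsAligned.cons_iff h1 hs').2 h2⟩

theorem IsAligned.greedySortable (h : IsAligned cs c w) (hsupp : InvSuppIn cs c w)
    (hnd : c.Nodup) : GreedySortable cs c w := by
  induction hn : cs.length w + c.length generalizing c w with
  | zero =>
    obtain rfl : c = [] := List.length_eq_zero_iff.1 (by lia)
    obtain rfl : w = 1 := cs.length_eq_zero_iff.1 (by lia)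
    exact .one
  | succ n ih =>
    cases c with
    | nil =>
      obtain rfl : w = 1 := eq_one_of_no_leftDescent fun s hs => by
        have := hsupp _ (isInv_simpleRoot_iff.2 hs) s (by simp)
        rw [simpleRoot_self] at this
        exact one_ne_zero this
      exact .one
    | cons s c =>
      by_cases hs : cs.length (cs.simple s * w) < cs.length w
      · refine .take hs (ih (h.simple_mul hsupp hnd hs) (hsupp.simple_mul hs)
          (nodup_rotate hnd) ?_)
        have := (cs.isLeftDescent_iff).1 hs
        simp only [List.length_append, List.length_cons, List.length_nil] at hn ⊢
        lia
      · have hw := (h.isWordIn hsupp hnd hs).invSuppIn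
        refine .skip hs (ih ((IsAligned.cons_iff hw (List.nodup_cons.1 hnd).1).1 h) hw
          (List.nodup_cons.1 hnd).2 ?_)
        simp only [List.length_cons] at hn
        lia

end GreedySorting

section Dichotomy

variable [Fintype B] [DecidableEq B] {cs : CoxeterSystem M W} {c : List B} {s : B}
  {ρ γ β : B → ℝ} {w : W}

lemma IsAntialigned.of_simple_mul (h : IsAntialigned cs (c ++ [s]) (cs.simple s * w))
    (hall : ∀ b, b ∈ s :: c) (hnd : (s :: c).Nodup)
    (hs : cs.length (cs.simple s * w) < cs.length w) : IsAntialigned cs (s :: c) w := by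
  intro ρ γ β ht hγ
  have hsupp (x : B → ℝ) : SuppIn (s :: c) x := fun j hj => absurd (hall j) hj
  by_cases hρ : ρ = simpleRoot s
  · obtain ⟨a, b, ha, hb, hab⟩ := ht.comb
    exact (hρ ▸ isInv_simpleRoot_iff.2 hs : IsInv cs w ρ).add hγ ha hb ht.mid hab
  · have := h _ _ _ (ht.rotate hnd hρ (hsupp β))
      ((isInv_simple_mul_iff ht.right (ht.right_ne hnd (hsupp ρ))).2 hγ)
    exact (isInv_simple_mul_iff ht.mid (ht.mid_ne s)).1 this

lemma HasContractedCover.of_simple_mul (h : HasContractedCover cs (c ++ [s]) (cs.simple s * w))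
    (hall : ∀ b, b ∈ s :: c) (hnd : (s :: c).Nodup)
    (hs : cs.length (cs.simple s * w) < cs.length w) : HasContractedCover cs (s :: c) w := by
  obtain ⟨r, ρ, γ, ht, hγ, hρ⟩ := h
  have hsupp (x : B → ℝ) : SuppIn (s :: c) x := fun j hj => absurd (hall j) hj
  have hγs := hγ.ne_simpleRoot (not_lt_simple_mul hs)
  have ht' := ht.rotate_symm hnd hγs (hsupp _)
  rw [geomRep_mul, geomRep_simple_simple] at ht'
  refine ⟨r, _, _, ht', (isInv_simple_mul_iff' ht.right hγs).1 hγ, fun hc => hρ ?_⟩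
  exact (isInv_simple_mul_iff' ht.left (ht.left_ne hnd (hsupp γ))).2 hc

lemma IsTriple.rotate_iff_of_orthogonal (hall : ∀ b, b ∈ s :: c) (hnd : (s :: c).Nodup)
    (hs : γ s = 0) (hγ : coxForm M (simpleRoot s) γ = 0) :
    IsTriple cs (c ++ [s]) ρ γ β ↔ IsTriple cs (s :: c) ρ γ β := by
  have hsupp (x : B → ℝ) : SuppIn (s :: c) x := fun j hj => absurd (hall j) hj
  have h := skewForm_cons_eq (M := M) hnd (hsupp ρ) (hsupp γ)
  rw [hs, hγ] at h
  have h' : skewForm M (s :: c) ρ γ = skewForm M (c ++ [s]) ρ γ := by linarith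
  constructor
  · intro ht
    exact ⟨ht.left, ht.right, ht.mid, ht.comb, h' ▸ ht.skew_pos⟩
  · intro ht
    exact ⟨ht.left, ht.right, ht.mid, ht.comb, h' ▸ ht.skew_pos⟩

lemma IsWordIn.orthogonal_of_isInv {J : List B} (hw : IsWordIn cs J w) (hs : s ∉ J)
    (hfix : geomRep cs w (simpleRoot s) = simpleRoot s) (hγ : IsInv cs w γ) :
    γ s = 0 ∧ coxForm M (simpleRoot s) γ = 0 := by
  have h0 := hw.invSuppIn γ hγ s hs
  refine ⟨h0, le_antisymm (h0 ▸ coxForm_simpleRoot_le hγ.1.2 s) ?_⟩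
  have h1 := coxForm_simpleRoot_le (M := M) hγ.neg_isPosRoot.2 s
  rw [Pi.neg_apply, hw.inv.geomRep_apply hs, h0, neg_zero, map_neg,
    ← coxForm_geomRep cs w, hfix, geomRep_self_inv] at h1
  linarith

lemma IsTriple.orthogonal_right (ht : IsTriple cs c ρ γ β) (hs : β s = 0)
    (hβ : coxForm M (simpleRoot s) β = 0) : γ s = 0 ∧ coxForm M (simpleRoot s) γ = 0 := by
  obtain ⟨a, b, ha, hb, rfl⟩ := ht.comb
  simp only [Pi.add_apply, Pi.smul_apply, smul_eq_mul] at hs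
  simp only [map_add, map_smul, smul_eq_mul] at hβ
  have h1 : 0 ≤ ρ s := ht.left.2 s
  have h2 : 0 ≤ γ s := ht.right.2 s
  have h3 : 0 ≤ a * ρ s := by positivity
  have h4 : 0 ≤ b * γ s := by positivity
  have h5 : ρ s = 0 := (mul_eq_zero.1 (by linarith : a * ρ s = 0)).resolve_left ha.ne'
  have h6 : γ s = 0 := (mul_eq_zero.1 (by linarith : b * γ s = 0)).resolve_left hb.ne'
  have h7 : coxForm M (simpleRoot s) ρ ≤ 0 := h5 ▸ coxForm_simpleRoot_le ht.left.2 s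
  have h8 : coxForm M (simpleRoot s) γ ≤ 0 := h6 ▸ coxForm_simpleRoot_le ht.right.2 s
  refine ⟨h6, le_antisymm h8 ?_⟩
  nlinarith

/-- An aligned element is antialigned or has a contracted cover. -/
theorem IsAligned.isAntialigned_or_hasContractedCover (h : IsAligned cs c w)
    (hall : ∀ b, b ∈ c) (hnd : c.Nodup) : IsAntialigned cs c w ∨ HasContractedCover cs c w := by
  suffices H : ∀ p q : List B, ∀ w : W, (p ++ q).Nodup → (∀ b, b ∈ p ++ q) →
      (∀ a ∈ q, ¬ cs.length (cs.simple a * w) < cs.length w ∧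
        geomRep cs w (simpleRoot a) = simpleRoot a) → IsAligned cs (p ++ q) w →
      IsAntialigned cs (p ++ q) w ∨ HasContractedCover cs (p ++ q) w by
    have := H c [] w
    simp only [List.append_nil] at this
    exact this hnd hall (by simp) h
  clear h hall hnd
  intro p q w
  induction hn : cs.length w using Nat.strong_induction_on generalizing p q w with
  | _ n ih =>
  subst hn
  induction p generalizing q with
  | nil =>
    intro _ hall hq _
    obtain rfl : w = 1 := eq_one_of_no_leftDescent fun s => (hq s (hall s)).1
    exact Or.inl fun _ γ _ _ hγ => absurd hγ (not_isInv_one γ)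
  | cons s p ihp =>
    rw [List.cons_append]
    intro hnd hall hq hal
    have hall' : ∀ b, b ∈ (p ++ q) ++ [s] := fun b => by
      have := hall b
      simp only [List.mem_cons, List.mem_append] at this ⊢
      tauto
    by_cases hs : cs.length (cs.simple s * w) < cs.length w
    · have := ih _ hs ((p ++ q) ++ [s]) [] (cs.simple s * w) rfl
      simp only [List.append_nil] at this
      rcases this (nodup_rotate hnd) hall' (by simp)
        (hal.simple_mul (invSuppIn_of_forall_mem hall) hnd hs) with h | h
      · exact Or.inl (h.of_simple_mul hall hnd hs)
      · exact Or.inr (h.of_simple_mul hall hnd hs)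
    have hsc := (List.nodup_cons.1 hnd).1
    have hw := hal.isWordIn (invSuppIn_of_forall_mem hall) hnd hs
    by_cases hfix : geomRep cs w (simpleRoot s) = simpleRoot s
    · have hal' : IsAligned cs ((p ++ q) ++ [s]) w := fun ρ γ β ht hβ => by
        obtain ⟨h1, h2⟩ := hw.orthogonal_of_isInv hsc hfix hβ
        obtain ⟨h3, h4⟩ := ht.orthogonal_right h1 h2
        exact hal ρ γ β ((IsTriple.rotate_iff_of_orthogonal hall hnd h3 h4).1 ht) hβ
      have := ihp (q ++ [s])
      simp only [← List.append_assoc] at this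
      rcases this (nodup_rotate hnd) hall' (fun a ha => by
        rw [List.mem_append, List.mem_singleton] at ha
        rcases ha with ha | rfl
        · exact hq a ha
        · exact ⟨hs, hfix⟩) hal' with h | ⟨r, ρ, γ, ht, hγ, hρ⟩
      · refine Or.inl fun ρ γ β ht hγ => ?_
        obtain ⟨h1, h2⟩ := hw.orthogonal_of_isInv hsc hfix hγ
        exact h ρ γ β ((IsTriple.rotate_iff_of_orthogonal hall hnd h1 h2).2 ht) hγ
      · obtain ⟨h1, h2⟩ := hw.orthogonal_of_isInv hsc hfix hγ
        exact Or.inr ⟨r, ρ, γ, (IsTriple.rotate_iff_of_orthogonal hall hnd h1 h2).1 ht, hγ, hρ⟩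
    · obtain ⟨v', γ, hv', -, hγ, ht⟩ := exists_isTriple_of_ne hnd hw hfix
      refine Or.inr ⟨s, _, γ, ht, hγ, fun hc => ?_⟩
      have := hc.2 s
      rw [hw.inv.geomRep_apply hsc, hv'.geomRep_apply hsc, simpleRoot_self] at this
      norm_num at this

end Dichotomy

section Longest

variable [Fintype B] [DecidableEq B] {cs : CoxeterSystem M W} {c : List B}
  {ρ γ β : B → ℝ} {w w₀ : W}

lemma geomRep_inv_longest_nonpos (hw₀ : ∀ u : W, cs.length u ≤ cs.length w₀) {x : B → ℝ}
    (hx : 0 ≤ x) : geomRep cs w₀⁻¹ x ≤ 0 := by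
  rw [← sum_smul_simpleRoot x, map_sum]
  refine Finset.sum_nonpos fun j _ => ?_
  rw [map_smul]
  refine smul_nonpos_of_nonneg_of_nonpos (hx j) (geomRep_simpleRoot_nonpos cs ?_)
  have h1 := hw₀ (w₀⁻¹ * cs.simple j)
  have h2 := cs.length_mul_simple w₀⁻¹ j
  rw [cs.length_inv] at h2 ⊢
  lia

lemma isInv_mul_longest_iff (hw₀ : ∀ u : W, cs.length u ≤ cs.length w₀) (hβ : IsPosRoot cs β) :
    IsInv cs (w * w₀) β ↔ ¬ IsInv cs w β := by
  constructor
  · intro h h'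
    have h1 := geomRep_inv_longest_nonpos hw₀ (x := -geomRep cs w⁻¹ β) (by simpa using h'.2)
    rw [map_neg, ← geomRep_mul, ← mul_inv_rev, Left.neg_nonpos_iff] at h1
    exact h.neg_isPosRoot.ne_zero (neg_eq_zero.2 (eq_zero_of_nonneg_of_nonpos h1 h.2))
  · intro h
    refine ⟨hβ, ?_⟩
    rw [mul_inv_rev, geomRep_mul]
    exact geomRep_inv_longest_nonpos hw₀ (hβ.inv_of_not_isInv h).2

lemma IsTriple.reverse_iff : IsTriple cs c.reverse γ ρ β ↔ IsTriple cs c ρ γ β := by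
  constructor <;> rintro ⟨h1, h2, h3, ⟨a, b, ha, hb, rfl⟩, h5⟩
  · exact ⟨h2, h1, h3, ⟨b, a, hb, ha, add_comm _ _⟩, by rwa [skewForm_reverse] at h5⟩
  · exact ⟨h2, h1, h3, ⟨b, a, hb, ha, add_comm _ _⟩, by rwa [skewForm_reverse]⟩

theorem isAntialigned_iff_isAligned_mul_longest (hw₀ : ∀ u : W, cs.length u ≤ cs.length w₀) :
    IsAntialigned cs c w ↔ IsAligned cs c.reverse (w * w₀) := by
  constructor
  · intro h ρ γ β ht hβ
    rw [isInv_mul_longest_iff hw₀ ht.mid] at hβ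
    rw [isInv_mul_longest_iff hw₀ ht.left]
    exact fun hρ => hβ (h γ ρ β (IsTriple.reverse_iff.1 ht) hρ)
  · intro h ρ γ β ht hγ
    by_contra hβ
    rw [← isInv_mul_longest_iff hw₀ ht.mid] at hβ
    have := h γ ρ β (IsTriple.reverse_iff.2 ht) hβ
    rw [isInv_mul_longest_iff hw₀ ht.right] at this
    exact this hγ

end Longest

section Pass

variable {cs : CoxeterSystem M W} {c : List B} {s : B} {w : W}

lemma foldl_pass (l : List B) (u : W) :
    c.foldl (fun p q =>
      if cs.length (cs.simple q * p.2) < cs.length p.2 then (p.1 ++ [q], cs.simple q * p.2)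
      else p) (l, u) = (l ++ (pass cs c u).1, (pass cs c u).2) := by
  unfold pass
  induction c generalizing l u with
  | nil => simp
  | cons s c ih =>
    rw [List.foldl_cons, List.foldl_cons]
    split_ifs
    · rw [ih, ih ([] ++ [s])]
      simp
    · rw [ih]

lemma pass_cons_of_lt (h : cs.length (cs.simple s * w) < cs.length w) :
    pass cs (s :: c) w =
      (s :: (pass cs c (cs.simple s * w)).1, (pass cs c (cs.simple s * w)).2) := by
  rw [pass, List.foldl_cons, if_pos h, foldl_pass]
  simp

lemma pass_cons_of_not_lt (h : ¬ cs.length (cs.simple s * w) < cs.length w) :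
    pass cs (s :: c) w = pass cs c w := by
  rw [pass, List.foldl_cons, if_neg h, foldl_pass]
  simp

lemma pass_sublist : (pass cs c w).1.Sublist c := by
  induction c generalizing w with
  | nil => simp [pass]
  | cons s c ih =>
    by_cases h : cs.length (cs.simple s * w) < cs.length w
    · rw [pass_cons_of_lt h]; exact ih.cons_cons s
    · rw [pass_cons_of_not_lt h]; exact ih.cons s

lemma length_pass : cs.length (pass cs c w).2 + (pass cs c w).1.length = cs.length w := by
  induction c generalizing w with
  | nil => simp [pass]
  | cons s c ih =>
    by_cases h : cs.length (cs.simple s * w) < cs.length w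
    · rw [pass_cons_of_lt h]
      have h1 := (cs.isLeftDescent_iff).1 h
      have h2 := ih (w := cs.simple s * w)
      simp only [List.length_cons]
      lia
    · rw [pass_cons_of_not_lt h]; exact ih

lemma not_lt_of_pass_eq_nil (h : (pass cs c w).1 = []) (hs : s ∈ c) :
    ¬ cs.length (cs.simple s * w) < cs.length w := by
  induction c with
  | nil => simp at hs
  | cons t c ih =>
    by_cases ht : cs.length (cs.simple t * w) < cs.length w
    · simp [pass_cons_of_lt ht] at h
    · rw [pass_cons_of_not_lt ht] at h
      rcases List.mem_cons.1 hs with rfl | hs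
      · exact ht
      · exact ih h hs

lemma length_pass_lt (hall : ∀ b, b ∈ c) (hw : w ≠ 1) :
    cs.length (pass cs c w).2 < cs.length w := by
  have h1 := length_pass (cs := cs) (c := c) (w := w)
  have h2 : (pass cs c w).1 ≠ [] := fun h =>
    hw (eq_one_of_no_leftDescent fun s => not_lt_of_pass_eq_nil h (hall s))
  have h3 := List.length_pos_iff.2 h2
  lia

lemma pass_filter [DecidableEq B] {K : List B} (h : (pass cs c w).1 ⊆ K) :
    pass cs (c.filter (· ∈ K)) w = pass cs c w := by
  induction c generalizing w with
  | nil => rfl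
  | cons s c ih =>
    by_cases hs : cs.length (cs.simple s * w) < cs.length w
    · rw [pass_cons_of_lt hs, List.cons_subset] at h
      rw [List.filter_cons_of_pos (by simpa using h.1), pass_cons_of_lt hs, pass_cons_of_lt hs,
        ih h.2]
    · rw [pass_cons_of_not_lt hs] at h
      by_cases hK : s ∈ K
      · rw [List.filter_cons_of_pos (by simpa using hK), pass_cons_of_not_lt hs,
          pass_cons_of_not_lt hs, ih h]
      · rw [List.filter_cons_of_neg (by simpa using hK), pass_cons_of_not_lt hs, ih h]

lemma filter_mem_eq_of_sublist [DecidableEq B] {K : List B} (h : K.Sublist c) (hnd : c.Nodup) :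
    c.filter (· ∈ K) = K := by
  induction h with
  | slnil => rfl
  | cons a h ih =>
    rw [List.nodup_cons] at hnd
    rw [List.filter_cons_of_neg (by simpa using fun ha => hnd.1 (h.subset ha)), ih hnd.2]
  | cons_cons a h ih =>
    rw [List.nodup_cons] at hnd
    rw [List.filter_cons_of_pos (by simp)]
    congr 1
    rw [← ih hnd.2]
    refine List.filter_congr fun x hx => ?_
    have : x ≠ a := by rintro rfl; exact hnd.1 hx
    simp [this, hx]

lemma pass_eq_of_sublist {K : List B} (h : K.Sublist c) (hnd : c.Nodup) (hK : (pass cs c w).1 ⊆ K) :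
    pass cs K w = pass cs c w := by
  classical
  rw [← pass_filter hK, filter_mem_eq_of_sublist h hnd]

lemma InvSuppIn.pass_subset [Fintype B] [DecidableEq B] {K : List B} (h : InvSuppIn cs K w) :
    (pass cs c w).1 ⊆ K := by
  induction c generalizing w with
  | nil => simp [pass]
  | cons s c ih =>
    by_cases hs : cs.length (cs.simple s * w) < cs.length w
    · have hsK : s ∈ K := by
        by_contra hc
        have := h _ (isInv_simpleRoot_iff.2 hs) s hc
        rw [simpleRoot_self] at this
        exact one_ne_zero this
      rw [pass_cons_of_lt hs, List.cons_subset]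
      refine ⟨hsK, ih fun β hβ j hj => ?_⟩
      have h1 := h _ ((isInv_simple_mul_iff' hβ.1 (hβ.ne_simpleRoot (not_lt_simple_mul hs))).1 hβ)
        j hj
      rwa [geomRep_simple_apply_of_ne cs] at h1
      rintro rfl
      exact hj hsK
    · rw [pass_cons_of_not_lt hs]; exact ih h

lemma remainder_succ' (n : ℕ) :
    remainder cs c w (n + 1) = remainder cs c (pass cs c w).2 n := by
  induction n with
  | zero => rfl
  | succ n ih => rw [remainder, ih, remainder]

lemma factor_succ' (n : ℕ) : factor cs c w (n + 1) = factor cs c (pass cs c w).2 n := by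
  rw [factor, factor, remainder_succ']

lemma GreedySortable.cons_iff_of_lt (h : cs.length (cs.simple s * w) < cs.length w) :
    GreedySortable cs (s :: c) w ↔ GreedySortable cs (c ++ [s]) (cs.simple s * w) :=
  ⟨fun hg => by cases hg with
    | take _ hg => exact hg
    | skip hn _ => exact absurd h hn, .take h⟩

lemma GreedySortable.cons_iff_of_not_lt (h : ¬ cs.length (cs.simple s * w) < cs.length w) :
    GreedySortable cs (s :: c) w ↔ GreedySortable cs c w :=
  ⟨fun hg => by cases hg with
    | take hn _ => exact absurd hn h
    | skip _ hg => exact hg, .skip h⟩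

lemma greedySortable_append_iff (l : List B) :
    GreedySortable cs (c ++ l) w ↔
      GreedySortable cs (l ++ (pass cs c w).1) (pass cs c w).2 := by
  induction c generalizing l w with
  | nil => simp [pass]
  | cons s c ih =>
    by_cases h : cs.length (cs.simple s * w) < cs.length w
    · rw [List.cons_append, GreedySortable.cons_iff_of_lt h, List.append_assoc, ih,
        pass_cons_of_lt h, List.append_assoc, List.singleton_append]
    · rw [List.cons_append, GreedySortable.cons_iff_of_not_lt h, ih, pass_cons_of_not_lt h]

lemma greedySortable_iff_pass :
    GreedySortable cs c w ↔ GreedySortable cs (pass cs c w).1 (pass cs c w).2 := by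
  simpa using greedySortable_append_iff (cs := cs) (c := c) (w := w) []

lemma GreedySortable.of_one : GreedySortable cs c 1 := by
  induction c with
  | nil => exact .one
  | cons s c ih => exact .skip (by simp) ih

theorem IsSortable.greedySortable (h : IsSortable cs c w) (hall : ∀ b, b ∈ c) (hnd : c.Nodup) :
    GreedySortable cs c w := by
  suffices H : ∀ K : List B, K.Sublist c → factor cs c w 0 ⊆ K → GreedySortable cs K w from
    H c (List.Sublist.refl c) pass_sublist.subset
  induction hn : cs.length w using Nat.strong_induction_on generalizing w with
  | _ n ih =>
  subst hn
  intro K hK h0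
  rcases eq_or_ne w 1 with rfl | hw
  · exact .of_one
  rw [greedySortable_iff_pass, pass_eq_of_sublist (w := w) hK hnd h0]
  refine ih _ (length_pass_lt hall hw) (fun n q hq => ?_) rfl _ pass_sublist fun q hq => ?_
  · rw [← factor_succ'] at hq ⊢
    exact h _ _ hq
  · rw [← factor_succ'] at hq
    exact h _ _ hq

theorem GreedySortable.isSortable [Fintype B] [DecidableEq B] (h : GreedySortable cs c w)
    (hnd : c.Nodup) : IsSortable cs c w := by
  have key : ∀ n, GreedySortable cs (factor cs c w n) (remainder cs c w (n + 1)) →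
      factor cs c w (n + 1) ⊆ factor cs c w n := fun n hn =>
    (hn.invSuppIn_and_isAligned (pass_sublist.nodup hnd)).1.pass_subset
  have H : ∀ n, GreedySortable cs (factor cs c w n) (remainder cs c w (n + 1)) := by
    intro n
    induction n with
    | zero => exact greedySortable_iff_pass.1 h
    | succ n ih =>
      have h1 := greedySortable_iff_pass.1 ih
      have h2 : pass cs (factor cs c w n) (remainder cs c w (n + 1)) =
          pass cs c (remainder cs c w (n + 1)) := pass_eq_of_sublist pass_sublist hnd (key n ih)
      rwa [h2] at h1
  exact fun n q hq => key n (H n) hq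

/-- A `c`-sortable element is the same as a `c`-aligned one. -/
theorem isSortable_iff_isAligned [Fintype B] [DecidableEq B] (hall : ∀ b, b ∈ c) (hnd : c.Nodup) :
    IsSortable cs c w ↔ IsAligned cs c w :=
  ⟨fun h => ((h.greedySortable hall hnd).invSuppIn_and_isAligned hnd).2,
    fun h => (h.greedySortable (invSuppIn_of_forall_mem hall) hnd).isSortable hnd⟩

end Pass

section Cover

variable [Fintype B] [DecidableEq B] {cs : CoxeterSystem M W} {c : List B} {r : B}
  {ρ γ β : B → ℝ} {w v : W}

lemma IsTriple.left_ne_mid (h : IsTriple cs c ρ γ β) : ρ ≠ β := by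
  rintro rfl
  obtain ⟨a, b, ha, hb, hab⟩ := h.comb
  have h1 := h.skew_pos
  have h2 := congrArg (skewForm M c ρ) hab
  rw [skewForm_add_right, skewForm_smul_right, skewForm_smul_right, skewForm_self] at h2
  nlinarith

lemma IsTriple.right_ne_mid (h : IsTriple cs c ρ γ β) : γ ≠ β :=
  fun hγβ => (IsTriple.reverse_iff.2 h).left_ne_mid hγβ

/-- Every cover of an aligned and antialigned element is aligned. -/
lemma IsAligned.mul_simple (h : IsAligned cs c w) (h' : IsAntialigned cs c w)
    (hr : cs.length w < cs.length (w * cs.simple r)) : IsAligned cs c (w * cs.simple r) := by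
  intro ρ γ β ht hβ
  rcases (isInv_mul_simple_iff hr).1 hβ with hβw | hβτ
  · exact (h ρ γ β ht hβw).mul_simple hr
  obtain ⟨a, b, ha, hb, hab⟩ := ht.comb
  refine (hβ.or_of_add ht.left ht.right ha hb hab).resolve_right fun hγ => ?_
  rcases (isInv_mul_simple_iff hr).1 hγ with hγ | hγ
  · have := (h' ρ γ β ht hγ).2
    rw [hβτ, geomRep_inv_self] at this
    exact (isPosRoot_simpleRoot (cs := cs) r).not_nonpos this
  · exact ht.right_ne_mid (hγ.trans hβτ.symm)

omit [Fintype B] [DecidableEq B] in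
lemma weakLE_refl : weakLE cs w w := by simp [weakLE]

omit [Fintype B] [DecidableEq B] in
lemma weakLE_mul_simple (hr : cs.length w < cs.length (w * cs.simple r)) :
    weakLE cs w (w * cs.simple r) := by
  have := cs.length_mul_simple w r
  rw [weakLE, inv_mul_cancel_left, cs.length_simple]
  lia

omit [Fintype B] [DecidableEq B] in
lemma exists_cover_weakLE {u : W} (h : weakLE cs w u) (hne : u ≠ w) :
    ∃ r, cs.length w < cs.length (w * cs.simple r) ∧ weakLE cs (w * cs.simple r) u := by
  have hne' : w⁻¹ * u ≠ 1 := fun h1 => hne (inv_mul_eq_one.1 h1).symm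
  obtain ⟨r, hr⟩ := cs.exists_leftDescent_of_ne_one hne'
  have h1 := (cs.isLeftDescent_iff).1 hr
  have e : (w * cs.simple r)⁻¹ * u = cs.simple r * (w⁻¹ * u) := by
    rw [mul_inv_rev, cs.inv_simple, mul_assoc]
  have h2 := cs.length_mul_le (w * cs.simple r) ((w * cs.simple r)⁻¹ * u)
  rw [mul_inv_cancel_left, e] at h2
  have h3 := cs.length_mul_simple w r
  unfold weakLE at h ⊢
  refine ⟨r, by lia, ?_⟩
  rw [e]
  lia

lemma weakLE_of_weakLE_mul_simple (hr : cs.length w < cs.length (w * cs.simple r))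
    (hv : weakLE cs v (w * cs.simple r)) (hτ : ¬ IsInv cs v (geomRep cs w (simpleRoot r))) :
    weakLE cs v w := by
  have hτpos : IsPosRoot cs (geomRep cs w (simpleRoot r)) :=
    (isPosRoot_simpleRoot r).geomRep _ (geomRep_simpleRoot_nonneg cs hr)
  have e : v⁻¹ * (w * cs.simple r) * cs.simple r = v⁻¹ * w := by
    rw [mul_assoc, cs.simple_mul_simple_cancel_right]
  have h1 : cs.length (v⁻¹ * w) < cs.length (v⁻¹ * (w * cs.simple r)) := by
    rw [← e]
    by_contra hc
    have h2 := geomRep_simpleRoot_nonneg cs (length_lt_mul_simple_of_not_lt hc)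
    rw [geomRep_mul, geomRep_mul, geomRep_simple_self, map_neg, map_neg,
      Left.nonneg_neg_iff] at h2
    exact hτ ⟨hτpos, h2⟩
  have h2 := cs.length_mul_simple (v⁻¹ * (w * cs.simple r)) r
  rw [e] at h2
  have h3 := cs.length_mul_simple w r
  unfold weakLE at hv ⊢
  lia

end Cover

/-- Let `w` be `c`-sortable.  The fiber of `w` under the downward Cambrian
projection, i.e. the set of `u ∈ W` with `w ≤ u` in right weak order such that every
`c`-sortable `v ≤ u` satisfies `v ≤ w`, is the singleton `{w}` if and only if `w w₀` is
`c⁻¹`-sortable. -/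
theorem statement1 [Finite W] (cs : CoxeterSystem M W)
    (c : List B) (hnd : c.Nodup) (hall : ∀ b : B, b ∈ c)
    (w₀ : W) (hw₀ : ∀ u : W, cs.length u ≤ cs.length w₀)
    (w : W) (hw : IsSortable cs c w) :
    {u : W | weakLE cs w u ∧
        ∀ v : W, IsSortable cs c v → weakLE cs v u → weakLE cs v w} = {w}
    ↔ IsSortable cs c.reverse (w * w₀) := by
  classical
  let _ : Fintype B := ⟨c.toFinset, fun b => by simpa using hall b⟩
  have hal := (isSortable_iff_isAligned hall hnd).1 hw
  rw [isSortable_iff_isAligned (by simpa using hall) (List.nodup_reverse.2 hnd),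
    ← isAntialigned_iff_isAligned_mul_longest hw₀]
  constructor
  · intro hfib
    rcases hal.isAntialigned_or_hasContractedCover hall hnd with h | ⟨r, ρ, γ, ht, hγ, hρ⟩
    · exact h
    exfalso
    have hr : cs.length w < cs.length (w * cs.simple r) := by
      by_contra hc
      have := cs.length_mul_simple w r
      exact ht.mid.not_nonpos (geomRep_simpleRoot_nonpos cs (by lia))
    have hmem : w * cs.simple r ∈ ({w} : Set W) := by
      rw [← hfib]
      refine ⟨weakLE_mul_simple hr, fun v hv hvr => weakLE_of_weakLE_mul_simple hr hvr fun hτ => ?_⟩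
      have hv' : IsInv cs v ρ := (isSortable_iff_isAligned hall hnd).1 hv ρ γ _ ht hτ
      have hρ' := hv'.mul_right (y := v⁻¹ * (w * cs.simple r))
        (by rw [mul_inv_cancel_left]; exact hvr)
      rw [mul_inv_cancel_left, isInv_mul_simple_iff hr] at hρ'
      exact hρ'.elim hρ ht.left_ne_mid
    rw [Set.mem_singleton_iff.1 hmem] at hr
    exact lt_irrefl _ hr
  · intro hanti
    ext u
    constructor
    · rintro ⟨hu, hmax⟩
      by_contra hne
      obtain ⟨r, hr, hru⟩ := exists_cover_weakLE hu hne
      have h1 := hmax _ ((isSortable_iff_isAligned hall hnd).2 (hal.mul_simple hanti hr)) hru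
      unfold weakLE at h1
      lia
    · rintro rfl
      exact ⟨weakLE_refl, fun v _ h => h⟩

end CambrianPaper

end
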